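/- Explicit commutator formula: for all integers n ≥ 0 and i ≥ 0, setting m = n + i, for every f ∈ 𝒫_{Ỹ,Z̃} one has [Z̃_+Λ_Z̃^{m}, Ỹ_+Λ_Ỹ^{n}] f = Σ_{j=1}^{i} Ỹ_+( Λ_Ỹ^{n+i−j}( Z̃_+( Λ_Z̃^{n+j−1}( Δ f ) ) ) ) = [Ỹ_+Λ_Ỹ^{m}, Z̃_+Λ_Z̃^{n}] f, where [P,Q] f := P(Q f) − Q(P f) (in particular both commutators vanish on 𝒫_{Ỹ,Z̃} when i = 0). -/

import Mathlib

open MvPolynomial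

noncomputable section

/-- The base field `K = ℚ(b)`: rational functions in an indeterminate `b` over `ℚ`. -/
abbrev K : Type := RatFunc ℚ

/-- The indeterminate `b ∈ K`. -/
def bb : K := RatFunc.X

/-- `α = 1 + b`. -/
def alpha : K := 1 + bb

/-- Variables: `p i` (used for `i ≥ 1`) and `y i`, `y' i`, `z i`, `z' i` (`i ≥ 0`). -/
inductive Var : Type
  | p : ℕ → Var
  | y : ℕ → Var
  | y' : ℕ → Var
  | z : ℕ → Var
  | z' : ℕ → Var
  deriving DecidableEq

/-- The ambient polynomial ring `R′`. -/
abbrev R : Type := MvPolynomial Var K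

/-- The generic operator
`Λ_A = α Σ_{i,j≥1} i a_{i+j−1} ∂²/∂p_i∂a_{j−1} + Σ_{i,j≥1} a_{i−1} p_j ∂/∂a_{i+j−1}
     + b Σ_{i≥1} i a_i ∂/∂a_i` for the alphabet `a ∈ {y, y′, z, z′}`. -/
def Lam (a : ℕ → Var) (f : R) : R :=
  alpha • (∑ᶠ (i : ℕ) (j : ℕ), ((i + 1 : ℕ) : K) •
      (X (a (i + j + 1)) * pderiv (Var.p (i + 1)) (pderiv (a j) f)))
    + (∑ᶠ (i : ℕ) (j : ℕ), X (a i) * X (Var.p (j + 1)) * pderiv (a (i + j + 1)) f)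
    + bb • (∑ᶠ (i : ℕ), ((i + 1 : ℕ) : K) • (X (a (i + 1)) * pderiv (a (i + 1)) f))

/-- The generic shift operator `A_+ = Σ_{i≥0} a_{i+1} ∂/∂a_i`. -/
def Plus (a : ℕ → Var) (f : R) : R := ∑ᶠ (i : ℕ), X (a (i + 1)) * pderiv (a i) f

/-- The generic operator `Θ_A = Σ_{i≥1} p_i ∂/∂a_i`. -/
def Theta (a : ℕ → Var) (f : R) : R := ∑ᶠ (i : ℕ), X (Var.p (i + 1)) * pderiv (a (i + 1)) f

/-- `M_Z = α Σ_{i,j,k≥1} y′_{i+j−1} z′_{k−1} ∂²/∂y_{i+k−1}∂z_{j−1}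
         + Σ_{i,j,k≥1} y_{i+j−1} z_{k−1} ∂²/∂y′_{i+k−1}∂z′_{j−1}
         + b Σ_{i,j,k≥1} y′_{i+j−1} z′_{k−1} ∂²/∂y′_{i+k−1}∂z′_{j−1}`. -/
def MZ (f : R) : R :=
  alpha • (∑ᶠ (i : ℕ) (j : ℕ) (k : ℕ), X (Var.y' (i + j + 1)) * X (Var.z' k) *
      pderiv (Var.y (i + k + 1)) (pderiv (Var.z j) f))
    + (∑ᶠ (i : ℕ) (j : ℕ) (k : ℕ), X (Var.y (i + j + 1)) * X (Var.z k) *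
      pderiv (Var.y' (i + k + 1)) (pderiv (Var.z' j) f))
    + bb • (∑ᶠ (i : ℕ) (j : ℕ) (k : ℕ), X (Var.y' (i + j + 1)) * X (Var.z' k) *
      pderiv (Var.y' (i + k + 1)) (pderiv (Var.z' j) f))

/-- `M_Y`: obtained from `M_Z` by exchanging `y ↔ z` and `y′ ↔ z′` everywhere. -/
def MY (f : R) : R :=
  alpha • (∑ᶠ (i : ℕ) (j : ℕ) (k : ℕ), X (Var.z' (i + j + 1)) * X (Var.y' k) *
      pderiv (Var.z (i + k + 1)) (pderiv (Var.y j) f))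
    + (∑ᶠ (i : ℕ) (j : ℕ) (k : ℕ), X (Var.z (i + j + 1)) * X (Var.y k) *
      pderiv (Var.z' (i + k + 1)) (pderiv (Var.y' j) f))
    + bb • (∑ᶠ (i : ℕ) (j : ℕ) (k : ℕ), X (Var.z' (i + j + 1)) * X (Var.y' k) *
      pderiv (Var.z' (i + k + 1)) (pderiv (Var.y' j) f))

/-- `Λ_Ỹ = Λ_Y + Λ_{Y′} + M_Y`. -/
def LamYt (f : R) : R := Lam Var.y f + Lam Var.y' f + MY f

/-- `Λ_Z̃ = Λ_Z + Λ_{Z′} + M_Z`. -/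
def LamZt (f : R) : R := Lam Var.z f + Lam Var.z' f + MZ f

/-- `Ỹ_+ = Y_+ + Y′_+`. -/
def Ytplus (f : R) : R := Plus Var.y f + Plus Var.y' f

/-- `Z̃_+ = Z_+ + Z′_+`. -/
def Ztplus (f : R) : R := Plus Var.z f + Plus Var.z' f

/-- `Θ_Z̃ = ∂/∂z₀ + Σ_{i≥1} p_i ∂/∂z_i + Σ_{i,j≥0} y_{i+j} ∂²/∂y′_i∂z′_j`. -/
def ThZt (f : R) : R :=
  pderiv (Var.z 0) f + (∑ᶠ (i : ℕ), X (Var.p (i + 1)) * pderiv (Var.z (i + 1)) f)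
    + (∑ᶠ (i : ℕ) (j : ℕ), X (Var.y (i + j)) * pderiv (Var.y' i) (pderiv (Var.z' j) f))

/-- `Θ_Ỹ = ∂/∂y₀ + Σ_{i≥1} p_i ∂/∂y_i + Σ_{i,j≥0} z_{i+j} ∂²/∂z′_i∂y′_j`. -/
def ThYt (f : R) : R :=
  pderiv (Var.y 0) f + (∑ᶠ (i : ℕ), X (Var.p (i + 1)) * pderiv (Var.y (i + 1)) f)
    + (∑ᶠ (i : ℕ) (j : ℕ), X (Var.z (i + j)) * pderiv (Var.z' i) (pderiv (Var.y' j) f))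

/-- `Δ = α Σ_{i,j≥0} z′_i y′_j ∂²/∂y_i∂z_j + Σ_{i,j≥0} z_i y_j ∂²/∂y′_i∂z′_j
      + b Σ_{i,j≥0} z′_i y′_j ∂²/∂y′_i∂z′_j`. -/
def Delta (f : R) : R :=
  alpha • (∑ᶠ (i : ℕ) (j : ℕ), X (Var.z' i) * X (Var.y' j) *
      pderiv (Var.y i) (pderiv (Var.z j) f))
    + (∑ᶠ (i : ℕ) (j : ℕ), X (Var.z i) * X (Var.y j) *
      pderiv (Var.y' i) (pderiv (Var.z' j) f))
    + bb • (∑ᶠ (i : ℕ) (j : ℕ), X (Var.z' i) * X (Var.y' j) *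
      pderiv (Var.y' i) (pderiv (Var.z' j) f))

/-- `𝒫`: the subalgebra of polynomials in the `p`-variables only. -/
def Psub : Subalgebra K R := MvPolynomial.supported K (Set.range Var.p)

/-- `𝒫_Y`: the `K`-linear span of the monomials `p_λ` and `y_i·p_λ`. -/
def PY : Submodule K R :=
  Submodule.span K ((Psub : Set R) ∪
    {g : R | ∃ i : ℕ, ∃ f ∈ (Psub : Set R), g = X (Var.y i) * f})

/-- `𝒫_{Ỹ,Z̃}`: the `K`-linear span of the monomials
`p_λ, y_i·p_λ, z_j·p_λ, y_i·z_j·p_λ, y′_i·p_λ, z′_j·p_λ, y′_i·z′_j·p_λ`. -/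
def PYZt : Submodule K R :=
  Submodule.span K ((Psub : Set R) ∪
    {g : R | ∃ f ∈ (Psub : Set R),
      (∃ i : ℕ, g = X (Var.y i) * f) ∨ (∃ j : ℕ, g = X (Var.z j) * f) ∨
      (∃ i : ℕ, ∃ j : ℕ, g = X (Var.y i) * X (Var.z j) * f) ∨
      (∃ i : ℕ, g = X (Var.y' i) * f) ∨ (∃ j : ℕ, g = X (Var.z' j) * f) ∨
      (∃ i : ℕ, ∃ j : ℕ, g = X (Var.y' i) * X (Var.z' j) * f)})

/-- `Z̃_+ Λ_Z̃^m`. -/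
def ZL (m : ℕ) (f : R) : R := Ztplus (LamZt^[m] f)

/-- `Ỹ_+ Λ_Ỹ^n`. -/
def YL (n : ℕ) (f : R) : R := Ytplus (LamYt^[n] f)

section CommutatorAlgebra

variable {𝕜 E : Type*} [Field 𝕜] [Ring E] [Algebra 𝕜 E]

/-- `Q ^ i - B ^ i` telescopes when `Q - B = c • T` and `T` intertwines `Q` with `P`. -/
lemma pow_sub_pow_eq_sum_left {P Q B T : E} {c : 𝕜} (hQ : Q = B + c • T)
    (hPT : T * Q = P * T) (hPB : Commute P B) (i : ℕ) :
    Q ^ i - B ^ i = c • ∑ j ∈ Finset.range i, P ^ (i - 1 - j) * B ^ j * T := by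
  induction i with
  | zero => simp
  | succ i ih =>
    have h1 : Q ^ (i + 1) - B ^ (i + 1) = B * (Q ^ i - B ^ i) + c • (P ^ i * T) := by
      have h2 : T * Q ^ i = P ^ i * T := (SemiconjBy.pow_right (show SemiconjBy T Q P from hPT) i)
      rw [← h2, pow_succ', pow_succ', mul_sub]
      nth_rewrite 1 [hQ]
      rw [add_mul, smul_mul_assoc]
      abel
    rw [h1, ih, Finset.sum_range_succ', smul_add, mul_smul_comm, Finset.mul_sum]
    simp only [pow_zero, mul_one, Nat.add_sub_cancel, Nat.sub_zero]
    congr 2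
    refine Finset.sum_congr rfl fun j _ => ?_
    rw [show i - (j + 1) = i - 1 - j by omega, ← mul_assoc, ← mul_assoc,
      ← (hPB.pow_left _).eq, mul_assoc (P ^ _), ← pow_succ']

/-- `P ^ i - A ^ i` telescopes when `P - A = c • T` and `T` intertwines `A` with `B`. -/
lemma pow_sub_pow_eq_sum_right {P A B T : E} {c : 𝕜} (hP : P = A + c • T)
    (hTA : T * A = B * T) (i : ℕ) :
    P ^ i - A ^ i = c • ∑ j ∈ Finset.range i, P ^ (i - 1 - j) * B ^ j * T := by
  induction i with
  | zero => simp
  | succ i ih =>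
    have h1 : P ^ (i + 1) - A ^ (i + 1) = P * (P ^ i - A ^ i) + c • (B ^ i * T) := by
      have h2 : T * A ^ i = B ^ i * T := (SemiconjBy.pow_right (show SemiconjBy T A B from hTA) i)
      rw [← h2, pow_succ', pow_succ', mul_sub]
      rw [← smul_mul_assoc, show c • T = P - A by rw [hP]; abel, sub_mul]
      abel
    rw [h1, ih, Finset.sum_range_succ, smul_add, mul_smul_comm, Finset.mul_sum]
    simp only [Nat.add_sub_cancel, Nat.sub_self, pow_zero, one_mul]
    congr 2
    refine Finset.sum_congr rfl fun j hj => ?_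
    have := Finset.mem_range.1 hj
    rw [← mul_assoc, ← mul_assoc, ← pow_succ', show i - 1 - j + 1 = i - j by omega]

variable {u v A B T : E} {c : 𝕜}

/-- The commutator formula for operators satisfying degenerate-Hecke-type relations. -/
lemma commutator_of_relations (huv : Commute u v) (hT : T * T = 1)
    (hTA : T * A = B * T) (hBu : B * u = u * (B + c • T)) (hAv : A * v = v * (A + c • T))
    (hAB : (B + c • T) * A = (A + c • T) * B) (n i : ℕ) :
    (v * B ^ (n + i) * (u * A ^ n) - u * A ^ n * (v * B ^ (n + i))
      = c • ∑ j ∈ Finset.range i, u * A ^ (n + i - j - 1) * (v * B ^ (n + j)) * T) ∧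
    (u * A ^ (n + i) * (v * B ^ n) - v * B ^ n * (u * A ^ (n + i))
      = c • ∑ j ∈ Finset.range i, u * A ^ (n + i - j - 1) * (v * B ^ (n + j)) * T) := by
  have hTB : T * B = A * T := by
    calc T * B = T * (B * T) * T := by rw [mul_assoc, mul_assoc, hT, mul_one]
      _ = A * T := by rw [← hTA, ← mul_assoc, hT, one_mul]
  obtain ⟨P, hP⟩ : ∃ P, P = A + c • T := ⟨_, rfl⟩
  obtain ⟨Q, hQ⟩ : ∃ Q, Q = B + c • T := ⟨_, rfl⟩
  rw [← hQ] at hBu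
  rw [← hP] at hAv
  rw [← hP, ← hQ] at hAB
  have hPB : Commute P B := by
    change P * B = B * P
    rw [← hAB, hQ, hP, add_mul, mul_add, smul_mul_assoc, mul_smul_comm, hTA]
  have hQA : Commute Q A := by
    change Q * A = A * Q
    rw [hAB, hQ, hP, add_mul, mul_add, smul_mul_assoc, mul_smul_comm, hTB]
  have hTQ : T * Q = P * T := by
    rw [hQ, hP, add_mul, mul_add, smul_mul_assoc, mul_smul_comm, hTB]
  have hTC : T * (P * B) = P * B * T := by
    rw [← hAB, ← mul_assoc, hTQ, mul_assoc, hTA, hAB, mul_assoc]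
  have hBu' (k : ℕ) : B ^ k * u = u * Q ^ k :=
    (SemiconjBy.pow_right (show SemiconjBy u Q B from hBu.symm) k).eq.symm
  have hAv' (k : ℕ) : A ^ k * v = v * P ^ k :=
    (SemiconjBy.pow_right (show SemiconjBy v P A from hAv.symm) k).eq.symm
  have hTCn : T * (P * B) ^ n = (P * B) ^ n * T :=
    (SemiconjBy.pow_right (show SemiconjBy T (P * B) (P * B) from hTC) n)
  have hF (k l : ℕ) : u * A ^ k * (v * B ^ l) = u * v * (P ^ k * B ^ l) := by
    rw [mul_assoc, ← mul_assoc (A ^ k), hAv', mul_assoc, mul_assoc]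
  have hG (k l : ℕ) : v * B ^ l * (u * A ^ k) = u * v * (Q ^ l * A ^ k) := by
    rw [mul_assoc, ← mul_assoc (B ^ l), hBu', huv.eq, mul_assoc, mul_assoc]
  have hsum : ∑ j ∈ Finset.range i, u * A ^ (n + i - j - 1) * (v * B ^ (n + j)) * T
      = u * v * ((∑ j ∈ Finset.range i, P ^ (i - 1 - j) * B ^ j * T) * (P * B) ^ n) := by
    rw [Finset.sum_mul, Finset.mul_sum]
    refine Finset.sum_congr rfl fun j hj => ?_
    have := Finset.mem_range.1 hj
    rw [hF, mul_assoc _ T, hTCn, hPB.mul_pow, show n + i - j - 1 = (i - 1 - j) + n by omega,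
      show n + j = j + n by omega, pow_add, pow_add]
    have h : P ^ n * B ^ j = B ^ j * P ^ n := (hPB.pow_pow n j).eq
    simp only [mul_assoc]
    rw [← mul_assoc (P ^ n), h]
    simp only [mul_assoc]
  constructor
  · rw [hF, hG, ← mul_sub, hsum, ← mul_smul_comm, ← smul_mul_assoc,
      ← pow_sub_pow_eq_sum_left hQ hTQ hPB, sub_mul]
    congr 2
    · rw [← hAB, hQA.mul_pow, ← mul_assoc, ← pow_add, add_comm i n]
    · rw [hPB.eq, hPB.symm.mul_pow, ← mul_assoc, ← pow_add, add_comm i n, (hPB.pow_pow _ _).eq]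
  · rw [hF, hG, ← mul_sub, hsum, ← mul_smul_comm, ← smul_mul_assoc,
      ← pow_sub_pow_eq_sum_right hP hTA, sub_mul]
    congr 2
    · rw [hPB.mul_pow, ← mul_assoc, ← pow_add, add_comm i n]
    · rw [← hAB, hQA.eq, hQA.symm.mul_pow, ← mul_assoc, ← pow_add, add_comm i n,
        (hQA.pow_pow _ _).eq]

end CommutatorAlgebra

section LocallyFinite

variable {𝕜 M : Type*} [Field 𝕜] [AddCommGroup M] [Module 𝕜 M]

/-- A sequence of endomorphisms is locally finite if each vector is killed by almost all of them. -/
def LocFin (F : ℕ → Module.End 𝕜 M) : Prop := ∀ x, ∃ N, ∀ i, N ≤ i → F i x = 0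

lemma hasFiniteSupport_of_bound {M : Type*} [Zero M] {h : ℕ → M} {N : ℕ}
    (H : ∀ i, N ≤ i → h i = 0) : Function.HasFiniteSupport h := by
  refine (Set.finite_lt_nat N).subset fun i hi => ?_
  by_contra hc
  exact hi (H i (not_lt.1 hc))

lemma LocFin.hasFiniteSupport {F : ℕ → Module.End 𝕜 M} (hF : LocFin F) (x : M) :
    Function.HasFiniteSupport fun i => F i x :=
  hasFiniteSupport_of_bound (hF x).choose_spec

/-- The sum of a locally finite sequence of endomorphisms. -/
def lfsum (F : ℕ → Module.End 𝕜 M) (hF : LocFin F) : Module.End 𝕜 M where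
  toFun x := ∑ᶠ i, F i x
  map_add' x y := by
    simp only [map_add]
    exact finsum_add_distrib (hF.hasFiniteSupport x) (hF.hasFiniteSupport y)
  map_smul' c x := by
    simp only [map_smul, RingHom.id_apply]
    rw [smul_finsum' c (hF.hasFiniteSupport x)]

lemma lfsum_apply (F : ℕ → Module.End 𝕜 M) (hF : LocFin F) (x : M) :
    lfsum F hF x = ∑ᶠ i, F i x := rfl

lemma LocFin.mul_left {F : ℕ → Module.End 𝕜 M} (hF : LocFin F) (G : Module.End 𝕜 M) :
    LocFin fun i => G * F i := fun x => by
  obtain ⟨N, hN⟩ := hF x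
  exact ⟨N, fun i hi => by simp [hN i hi]⟩

lemma LocFin.mul_right {F : ℕ → Module.End 𝕜 M} (hF : LocFin F) (G : Module.End 𝕜 M) :
    LocFin fun i => F i * G := fun x => hF (G x)

lemma LocFin.sub {F G : ℕ → Module.End 𝕜 M} (hF : LocFin F) (hG : LocFin G) :
    LocFin fun i => F i - G i := fun x => by
  obtain ⟨N, hN⟩ := hF x
  obtain ⟨N', hN'⟩ := hG x
  refine ⟨max N N', fun i hi => ?_⟩
  simp [hN i (le_trans (le_max_left _ _) hi), hN' i (le_trans (le_max_right _ _) hi)]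

lemma mul_lfsum {F : ℕ → Module.End 𝕜 M} (hF : LocFin F) (G : Module.End 𝕜 M) :
    G * lfsum F hF = lfsum (fun i => G * F i) (hF.mul_left G) := by
  ext x
  exact map_finsum G (hF.hasFiniteSupport x)

lemma lfsum_mul {F : ℕ → Module.End 𝕜 M} (hF : LocFin F) (G : Module.End 𝕜 M) :
    lfsum F hF * G = lfsum (fun i => F i * G) (hF.mul_right G) := rfl

lemma lfsum_sub {F G : ℕ → Module.End 𝕜 M} (hF : LocFin F) (hG : LocFin G) :
    lfsum F hF - lfsum G hG = lfsum (fun i => F i - G i) (hF.sub hG) := by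
  ext x
  exact (finsum_sub_distrib (hF.hasFiniteSupport x) (hG.hasFiniteSupport x)).symm

lemma lfsum_congr {F G : ℕ → Module.End 𝕜 M} (hF : LocFin F) (hG : LocFin G)
    (h : ∀ i, F i = G i) : lfsum F hF = lfsum G hG := by
  obtain rfl : F = G := funext h
  rfl

lemma lfsum_eq_single {F : ℕ → Module.End 𝕜 M} (hF : LocFin F) (j : ℕ)
    (h : ∀ i, i ≠ j → F i = 0) : lfsum F hF = F j := by
  ext x
  rw [lfsum_apply]
  exact finsum_eq_single _ j fun i hi => by simp [h i hi]

lemma commute_lfsum {F : ℕ → Module.End 𝕜 M} (hF : LocFin F) {G : Module.End 𝕜 M}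
    (h : ∀ i, Commute G (F i)) : Commute G (lfsum F hF) := by
  change _ * _ = _ * _
  rw [mul_lfsum, lfsum_mul]
  exact lfsum_congr _ _ fun i => h i

/-- Conjugation-symmetry of `X L + T L - L X` passes to locally finite sums. -/
lemma defect_lfsum {X X' T : Module.End 𝕜 M} {F F' : ℕ → Module.End 𝕜 M} (hF : LocFin F)
    (hF' : LocFin F')
    (h : ∀ i, X * F i + T * F i - F i * X = X' * F' i + T * F' i - F' i * X') :
    X * lfsum F hF + T * lfsum F hF - lfsum F hF * X
      = X' * lfsum F' hF' + T * lfsum F' hF' - lfsum F' hF' * X' := by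
  simp only [← add_mul]
  rw [mul_lfsum, mul_lfsum, lfsum_mul, lfsum_mul, lfsum_sub, lfsum_sub]
  exact lfsum_congr _ _ fun i => by simpa only [add_mul] using h i

end LocallyFinite

section Defect

variable {E : Type*} [Ring E] {T S u v : E}

lemma defect_pow_up (hTu : T * u = v * T)
    (hSu : S * u = u * S + u * T) (i : ℕ) :
    S * u ^ i + T * u ^ i - u ^ i * S
      = ∑ x ∈ Finset.HasAntidiagonal.antidiagonal i, u ^ x.1 * v ^ x.2 * T := by
  induction i with
  | zero => simp
  | succ i ih =>
    have h1 : S * u ^ (i + 1) + T * u ^ (i + 1) - u ^ (i + 1) * S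
        = (S * u ^ i + T * u ^ i - u ^ i * S) * u + u ^ (i + 1) * T := by
      have : u ^ i * (S * u) = u ^ (i + 1) * S + u ^ (i + 1) * T := by
        rw [hSu, mul_add, pow_succ, mul_assoc, mul_assoc]
      rw [sub_mul, add_mul, mul_assoc, mul_assoc, mul_assoc, this, ← pow_succ]
      abel
    rw [h1, ih, Finset.Nat.sum_antidiagonal_succ', Finset.sum_mul, add_comm]
    congr 1
    · simp
    · refine Finset.sum_congr rfl fun x _ => ?_
      rw [mul_assoc, hTu, ← mul_assoc, mul_assoc (u ^ _), ← pow_succ]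

lemma defect_pow_down (hTu : T * u = v * T)
    (hSu : S * u + T * u = u * S) (i : ℕ) :
    S * u ^ (i + 1) + T * u ^ (i + 1) - u ^ (i + 1) * S
      = u ^ (i + 1) * T + v ^ (i + 1) * T
        - ∑ x ∈ Finset.HasAntidiagonal.antidiagonal (i + 1), u ^ x.1 * v ^ x.2 * T := by
  induction i with
  | zero =>
    rw [Finset.Nat.sum_antidiagonal_succ']
    simp [hSu]
  | succ i ih =>
    have h1 : S * u ^ (i + 2) + T * u ^ (i + 2) - u ^ (i + 2) * S
        = (S * u ^ (i + 1) + T * u ^ (i + 1) - u ^ (i + 1) * S) * u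
          - u ^ (i + 1) * (v * T) := by
      have : u ^ (i + 1) * (S * u) = u ^ (i + 2) * S - u ^ (i + 1) * (v * T) := by
        rw [← hTu, pow_succ u (i + 1), mul_assoc _ u S, ← hSu, mul_add]
        abel
      rw [sub_mul, add_mul, mul_assoc, mul_assoc, mul_assoc, this, ← pow_succ]
      abel
    have h2 : (∑ x ∈ Finset.HasAntidiagonal.antidiagonal (i + 1), u ^ x.1 * v ^ x.2 * T) * u
        = (∑ x ∈ Finset.HasAntidiagonal.antidiagonal (i + 2), u ^ x.1 * v ^ x.2 * T)
          - u ^ (i + 2) * T := by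
      rw [Finset.Nat.sum_antidiagonal_succ' (n := i + 1), Finset.sum_mul, eq_sub_iff_add_eq',
        pow_zero, mul_one]
      congr 1
      refine Finset.sum_congr rfl fun x _ => ?_
      rw [mul_assoc, hTu, ← mul_assoc, mul_assoc (u ^ _), ← pow_succ]
    rw [show i + 1 + 1 = i + 2 from rfl, h1, ih, sub_mul, h2, add_mul, mul_assoc, mul_assoc, hTu,
      ← mul_assoc (v ^ _), ← pow_succ]
    abel

lemma involution_conj_pow (hT : T * T = 1) (hTu : T * u = v * T) (i : ℕ) :
    T * u ^ i * T = v ^ i := by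
  have : T * u ^ i = v ^ i * T := SemiconjBy.pow_right (show SemiconjBy T u v from hTu) i
  rw [this, mul_assoc, hT, mul_one]

lemma conj_sum_antidiagonal (hT : T * T = 1) (huv : Commute u v) (hTu : T * u = v * T)
    (hTv : T * v = u * T) (i : ℕ) :
    T * (∑ x ∈ Finset.HasAntidiagonal.antidiagonal i, u ^ x.1 * v ^ x.2 * T) * T
      = ∑ x ∈ Finset.HasAntidiagonal.antidiagonal i, u ^ x.1 * v ^ x.2 * T := by
  rw [Finset.mul_sum, Finset.sum_mul, ← Finset.Nat.sum_antidiagonal_swap]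
  refine Finset.sum_congr rfl fun x _ => ?_
  have h1 : T * u ^ x.2 = v ^ x.2 * T :=
    SemiconjBy.pow_right (show SemiconjBy T u v from hTu) _
  have h2 : T * v ^ x.1 = u ^ x.1 * T :=
    SemiconjBy.pow_right (show SemiconjBy T v u from hTv) _
  simp only [Prod.fst_swap, Prod.snd_swap]
  rw [mul_assoc, mul_assoc _ T T, hT, mul_one, ← mul_assoc, h1, mul_assoc, h2, ← mul_assoc,
    ((huv.pow_pow _ _).eq).symm]

lemma defect_conj (hT : T * T = 1) (L X : E) :
    T * (X * L + T * L - L * X) * T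
      = (T * X * T) * (T * L * T) + T * (T * L * T) - (T * L * T) * (T * X * T) := by
  have h (a b : E) : T * a * T * (T * b * T) = T * (a * b) * T := by
    rw [mul_assoc (T * a) T, ← mul_assoc T (T * b) T, ← mul_assoc T T b, hT, one_mul]
    noncomm_ring
  rw [h, h]
  noncomm_ring

lemma defect_symm_up (hT : T * T = 1) (huv : Commute u v) (hTu : T * u = v * T)
    (hTv : T * v = u * T) (hSu : S * u = u * S + u * T) (i : ℕ) :
    S * u ^ i + T * u ^ i - u ^ i * S
      = (T * S * T) * v ^ i + T * v ^ i - v ^ i * (T * S * T) := by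
  have h := defect_conj hT (u ^ i) S
  rw [involution_conj_pow hT hTu] at h
  rw [← h, defect_pow_up hTu hSu, conj_sum_antidiagonal hT huv hTu hTv]

lemma defect_symm_down (hT : T * T = 1) (huv : Commute u v) (hTu : T * u = v * T)
    (hTv : T * v = u * T) (hSu : S * u + T * u = u * S) (i : ℕ) :
    S * u ^ (i + 1) + T * u ^ (i + 1) - u ^ (i + 1) * S
      = (T * S * T) * v ^ (i + 1) + T * v ^ (i + 1) - v ^ (i + 1) * (T * S * T) := by
  have h := defect_conj hT (u ^ (i + 1)) S
  rw [involution_conj_pow hT hTu] at h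
  rw [← h, defect_pow_down hTu hSu, mul_sub, sub_mul,
    conj_sum_antidiagonal hT huv hTu hTv, mul_add, add_mul, ← mul_assoc, ← mul_assoc,
    involution_conj_pow hT hTu, involution_conj_pow hT hTv, add_comm (v ^ _ * T)]

end Defect

section Model

/-- Coefficient polynomials in the `p`-variables. -/
abbrev Coef : Type := MvPolynomial ℕ K

/-- Polynomials in two variables (tracking the indices of the two letters) over `Coef`. -/
def Model : Type := ℕ × ℕ →₀ Coef

instance : AddCommGroup Model := inferInstanceAs (AddCommGroup (ℕ × ℕ →₀ Coef))

instance : Module K Model := inferInstanceAs (Module K (ℕ × ℕ →₀ Coef))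

/-- The monomial with exponents `s`, `t` and a given coefficient. -/
def mon (s t : ℕ) : Coef →ₗ[K] Model :=
  (Finsupp.lsingle (s, t) : Coef →ₗ[K] (ℕ × ℕ →₀ Coef))

/-- Linear map on the model determined by its values on monomials. -/
def onMon {M : Type*} [AddCommGroup M] [Module K M] (w : ℕ → ℕ → Coef →ₗ[K] M) : Model →ₗ[K] M :=
  (Finsupp.lsum K fun x : ℕ × ℕ => w x.1 x.2 : (ℕ × ℕ →₀ Coef) →ₗ[K] M)

lemma onMon_mon {M : Type*} [AddCommGroup M] [Module K M] (w : ℕ → ℕ → Coef →ₗ[K] M) (s t : ℕ)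
    (g : Coef) : onMon w (mon s t g) = w s t g :=
  Finsupp.lsum_single K (fun x : ℕ × ℕ => w x.1 x.2) (s, t) g

lemma model_induction {p : Model → Prop} (x : Model) (h₀ : p 0)
    (hadd : ∀ x y, p x → p y → p (x + y)) (mon : ∀ s t g, p (mon s t g)) : p x :=
  Finsupp.induction_linear (motive := p) x h₀ hadd fun a g => mon a.1 a.2 g

lemma model_ext {M : Type*} [AddCommGroup M] [Module K M] {F G : Model →ₗ[K] M}
    (h : ∀ s t g, F (mon s t g) = G (mon s t g)) : F = G :=
  LinearMap.ext fun x => model_induction (p := fun x => F x = G x) x (by simp)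
    (fun x y hx hy => by rw [map_add, map_add, hx, hy]) h

/-- Apply a linear map to all coefficients. -/
def coefMap (φ : Coef →ₗ[K] Coef) : Module.End K Model := onMon fun s t => mon s t ∘ₗ φ

lemma coefMap_mon (φ : Coef →ₗ[K] Coef) (s t : ℕ) (g : Coef) :
    coefMap φ (mon s t g) = mon s t (φ g) := onMon_mon _ _ _ _

/-- Multiplication by the first variable. -/
def shiftU : Module.End K Model := onMon fun s t => mon (s + 1) t

/-- Multiplication by the second variable. -/
def shiftV : Module.End K Model := onMon fun s t => mon s (t + 1)

/-- Truncated division by the first variable. -/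
def downU : Module.End K Model :=
  onMon fun s t => match s with
    | 0 => 0
    | s + 1 => mon s t

/-- Truncated division by the second variable. -/
def downV : Module.End K Model :=
  onMon fun s t => match t with
    | 0 => 0
    | t + 1 => mon s t

/-- Exchange of the two variables. -/
def swapM : Module.End K Model := onMon fun s t => mon t s

/-- Euler operator of the first variable. -/
def degU : Module.End K Model := onMon fun s t => (s : K) • mon s t

/-- Euler operator of the second variable. -/
def degV : Module.End K Model := onMon fun s t => (t : K) • mon s t

/-- `u (f(u,u) - f(v,u)) / (u - v)` on monomials. -/
def stairU : Module.End K Model :=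
  onMon fun s t => ∑ k ∈ Finset.range s, mon (s + t - k) k

/-- `v (f(v,v) - f(v,u)) / (v - u)` on monomials. -/
def stairV : Module.End K Model :=
  onMon fun s t => ∑ k ∈ Finset.range t, mon k (s + t - k)

/-- Coefficientwise `∂/∂p_i`. -/
def derP (i : ℕ) : Module.End K Model := coefMap (pderiv i).toLinearMap

/-- Coefficientwise multiplication by `p_i`. -/
def mulP (i : ℕ) : Module.End K Model := coefMap (LinearMap.mulLeft K (X i))

variable (s t : ℕ) (g : Coef)

lemma shiftU_mon : shiftU (mon s t g) = mon (s + 1) t g := by simp [shiftU, onMon_mon]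
lemma shiftV_mon : shiftV (mon s t g) = mon s (t + 1) g := by simp [shiftV, onMon_mon]
lemma downU_mon_zero : downU (mon 0 t g) = 0 := by simp [downU, onMon_mon]
lemma downU_mon_succ : downU (mon (s + 1) t g) = mon s t g := by simp [downU, onMon_mon]
lemma downV_mon_zero : downV (mon s 0 g) = 0 := by simp [downV, onMon_mon]
lemma downV_mon_succ : downV (mon s (t + 1) g) = mon s t g := by simp [downV, onMon_mon]
lemma swapM_mon : swapM (mon s t g) = mon t s g := by simp [swapM, onMon_mon]
lemma degU_mon : degU (mon s t g) = (s : K) • mon s t g := by simp [degU, onMon_mon]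
lemma degV_mon : degV (mon s t g) = (t : K) • mon s t g := by simp [degV, onMon_mon]
lemma stairU_mon : stairU (mon s t g) = ∑ k ∈ Finset.range s, mon (s + t - k) k g := by
  simp [stairU, onMon_mon]
lemma stairV_mon : stairV (mon s t g) = ∑ k ∈ Finset.range t, mon k (s + t - k) g := by
  simp [stairV, onMon_mon]
lemma derP_mon (i : ℕ) : derP i (mon s t g) = mon s t (pderiv i g) := by
  simp [derP, coefMap_mon]
lemma mulP_mon (i : ℕ) : mulP i (mon s t g) = mon s t (X i * g) := by
  simp [mulP, coefMap_mon]

lemma shiftU_pow_mon (k : ℕ) : (shiftU ^ k) (mon s t g) = mon (s + k) t g := by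
  induction k with
  | zero => simp
  | succ k ih => rw [pow_succ', Module.End.mul_apply, ih, shiftU_mon, add_assoc]

lemma shiftV_pow_mon (k : ℕ) : (shiftV ^ k) (mon s t g) = mon s (t + k) g := by
  induction k with
  | zero => simp
  | succ k ih => rw [pow_succ', Module.End.mul_apply, ih, shiftV_mon, add_assoc]

lemma downU_pow_mon (k : ℕ) :
    (downU ^ k) (mon s t g) = if k ≤ s then mon (s - k) t g else 0 := by
  induction k generalizing s with
  | zero => simp
  | succ k ih =>
    rw [pow_succ, Module.End.mul_apply]
    cases s with
    | zero => simp [downU_mon_zero]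
    | succ s => rw [downU_mon_succ, ih]; simp

lemma downV_pow_mon (k : ℕ) :
    (downV ^ k) (mon s t g) = if k ≤ t then mon s (t - k) g else 0 := by
  induction k generalizing t with
  | zero => simp
  | succ k ih =>
    rw [pow_succ, Module.End.mul_apply]
    cases t with
    | zero => simp [downV_mon_zero]
    | succ t => rw [downV_mon_succ, ih]; simp

lemma swapM_mul_swapM : swapM * swapM = 1 := model_ext fun s t g => by simp [swapM_mon]

lemma swapM_mul_shiftU : swapM * shiftU = shiftV * swapM :=
  model_ext fun s t g => by simp [swapM_mon, shiftU_mon, shiftV_mon]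

lemma swapM_mul_shiftV : swapM * shiftV = shiftU * swapM :=
  model_ext fun s t g => by simp [swapM_mon, shiftU_mon, shiftV_mon]

lemma swapM_mul_downU : swapM * downU = downV * swapM :=
  model_ext fun s t g => by
    cases s <;> simp [swapM_mon, downU_mon_zero, downU_mon_succ, downV_mon_zero, downV_mon_succ]

lemma swapM_mul_downV : swapM * downV = downU * swapM :=
  model_ext fun s t g => by
    cases t <;> simp [swapM_mon, downU_mon_zero, downU_mon_succ, downV_mon_zero, downV_mon_succ]

lemma swapM_mul_degU : swapM * degU = degV * swapM :=
  model_ext fun s t g => by simp [swapM_mon, degU_mon, degV_mon]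

lemma swapM_mul_stairU : swapM * stairU = stairV * swapM :=
  model_ext fun s t g => by simp [swapM_mon, stairU_mon, stairV_mon, add_comm]

lemma swapM_mul_stairV : swapM * stairV = stairU * swapM :=
  model_ext fun s t g => by simp [swapM_mon, stairU_mon, stairV_mon, add_comm]

lemma swapM_conj_stairU : swapM * stairU * swapM = stairV := by
  rw [swapM_mul_stairU, mul_assoc, swapM_mul_swapM, mul_one]

lemma commute_shiftU_shiftV : Commute shiftU shiftV :=
  model_ext fun s t g => by simp [shiftU_mon, shiftV_mon]

lemma commute_downU_downV : Commute downU downV :=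
  model_ext fun s t g => by
    cases s <;> cases t <;> simp [downU_mon_zero, downU_mon_succ, downV_mon_zero, downV_mon_succ]

lemma commute_shiftU_downV : Commute shiftU downV :=
  model_ext fun s t g => by
    cases t <;> simp [shiftU_mon, downV_mon_zero, downV_mon_succ]

lemma commute_shiftV_downU : Commute shiftV downU :=
  model_ext fun s t g => by
    cases s <;> simp [shiftV_mon, downU_mon_zero, downU_mon_succ]

lemma commute_degU_shiftV : Commute degU shiftV :=
  model_ext fun s t g => by simp [degU_mon, shiftV_mon]

lemma commute_degU_downV : Commute degU downV :=
  model_ext fun s t g => by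
    cases t <;> simp [degU_mon, downV_mon_zero, downV_mon_succ]

lemma commute_degV_shiftU : Commute degV shiftU :=
  model_ext fun s t g => by simp [degV_mon, shiftU_mon]

lemma commute_degV_downU : Commute degV downU :=
  model_ext fun s t g => by
    cases s <;> simp [degV_mon, downU_mon_zero, downU_mon_succ]

lemma commute_degV_degU : Commute degV degU :=
  model_ext fun s t g => by simp [degU_mon, degV_mon, smul_smul, mul_comm]

/-- The operator commutes with all coefficientwise operators. -/
def CoefCommute (G : Module.End K Model) : Prop :=
  ∀ φ : Coef →ₗ[K] Coef, Commute G (coefMap φ)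

lemma coefCommute_of_mon {G : Module.End K Model}
    (h : ∀ (φ : Coef →ₗ[K] Coef) s t g,
      G (mon s t (φ g)) = coefMap φ (G (mon s t g))) : CoefCommute G :=
  fun φ => model_ext fun s t g => by simp [h, coefMap_mon]

lemma CoefCommute.derP {G : Module.End K Model} (h : CoefCommute G) (i : ℕ) :
    Commute G (derP i) := h _

lemma CoefCommute.mulP {G : Module.End K Model} (h : CoefCommute G) (i : ℕ) :
    Commute G (mulP i) := h _

lemma CoefCommute.pow {G : Module.End K Model} (h : CoefCommute G) (i : ℕ) :
    CoefCommute (G ^ i) := fun φ => (h φ).pow_left i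

lemma coefCommute_shiftU : CoefCommute shiftU :=
  coefCommute_of_mon fun φ s t g => by simp [coefMap_mon, shiftU_mon]

lemma coefCommute_shiftV : CoefCommute shiftV :=
  coefCommute_of_mon fun φ s t g => by simp [coefMap_mon, shiftV_mon]

lemma coefCommute_downU : CoefCommute downU :=
  coefCommute_of_mon fun φ s t g => by
    cases s <;> simp [coefMap_mon, downU_mon_zero, downU_mon_succ]

lemma coefCommute_downV : CoefCommute downV :=
  coefCommute_of_mon fun φ s t g => by
    cases t <;> simp [coefMap_mon, downV_mon_zero, downV_mon_succ]

lemma coefCommute_swapM : CoefCommute swapM :=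
  coefCommute_of_mon fun φ s t g => by simp [coefMap_mon, swapM_mon]

lemma coefCommute_degU : CoefCommute degU :=
  coefCommute_of_mon fun φ s t g => by simp [coefMap_mon, degU_mon]

lemma coefCommute_degV : CoefCommute degV :=
  coefCommute_of_mon fun φ s t g => by simp [coefMap_mon, degV_mon]

lemma coefCommute_stairU : CoefCommute stairU :=
  coefCommute_of_mon fun φ s t g => by simp [coefMap_mon, stairU_mon]

lemma coefCommute_stairV : CoefCommute stairV :=
  coefCommute_of_mon fun φ s t g => by simp [coefMap_mon, stairV_mon]

lemma commute_mulP_mulP (i j : ℕ) : Commute (mulP i) (mulP j) :=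
  model_ext fun s t g => by simp [mulP_mon, mul_left_comm]

lemma pderiv_pderiv_comm {R σ : Type*} [CommRing R] (i j : σ)
    (f : MvPolynomial σ R) : pderiv i (pderiv j f) = pderiv j (pderiv i f) := by
  classical
  have h : ⁅(pderiv i : Derivation R (MvPolynomial σ R) (MvPolynomial σ R)), pderiv j⁆ = 0 :=
    MvPolynomial.derivation_ext fun k => by
      rw [Derivation.commutator_apply, pderiv_X, pderiv_X]
      simp [Pi.single_apply, apply_ite (pderiv i), apply_ite (pderiv j)]
  have := congrArg (fun D => D f) h
  simpa [Derivation.commutator_apply, sub_eq_zero] using this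

lemma commute_derP_derP (i j : ℕ) : Commute (derP i) (derP j) :=
  model_ext fun s t g => by simp [derP_mon, pderiv_pderiv_comm i j]

lemma derP_mul_mulP (i j : ℕ) :
    derP i * mulP j = mulP j * derP i + if i = j then 1 else 0 :=
  model_ext fun s t g => by
    rcases eq_or_ne i j with rfl | h
    · simp [derP_mon, mulP_mon, add_comm]
    · simp [derP_mon, mulP_mon, h, pderiv_X_of_ne h.symm]

lemma stairU_mul_shiftU : stairU * shiftU = shiftU * stairU + shiftU * swapM :=
  model_ext fun s t g => by
    simp only [Module.End.mul_apply, LinearMap.add_apply, shiftU_mon, stairU_mon, swapM_mon,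
      map_sum, Finset.sum_range_succ]
    congr 1
    · refine Finset.sum_congr rfl fun k hk => ?_
      have := Finset.mem_range.1 hk
      congr 2
      omega
    · congr 2
      omega

lemma stairU_mul_downU : stairU * downU + swapM * downU = downU * stairU :=
  model_ext fun s t g => by
    cases s with
    | zero => simp [downU_mon_zero, stairU_mon]
    | succ s =>
      simp only [Module.End.mul_apply, LinearMap.add_apply, downU_mon_succ, stairU_mon, swapM_mon,
        map_sum, map_add, Finset.sum_range_succ]
      congr 1
      · refine Finset.sum_congr rfl fun k hk => ?_
        have := Finset.mem_range.1 hk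
        rw [show s + 1 + t - k = (s + t - k) + 1 by omega, downU_mon_succ]
      · rw [show s + 1 + t - s = t + 1 by omega, downU_mon_succ]

lemma exists_pderiv_eq_zero {R : Type*} [CommRing R] (f : MvPolynomial ℕ R) :
    ∃ N, ∀ i, N ≤ i → pderiv i f = 0 := by
  refine ⟨f.vars.sup id + 1, fun i hi => pderiv_eq_zero_of_notMem_vars fun h => ?_⟩
  have := Finset.le_sup (f := id) h
  simp only [id] at this
  omega

lemma locFin_of_mon {F : ℕ → Module.End K Model}
    (h : ∀ s t g, ∃ N, ∀ i, N ≤ i → F i (mon s t g) = 0) : LocFin F := fun x => by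
  refine model_induction (p := fun x => ∃ N, ∀ i, N ≤ i → F i x = 0) x ⟨0, fun i _ => by simp⟩ ?_ h
  rintro x y ⟨N, hN⟩ ⟨N', hN'⟩
  refine ⟨max N N', fun i hi => ?_⟩
  simp [hN i (le_trans (le_max_left _ _) hi), hN' i (le_trans (le_max_right _ _) hi)]

lemma locFin_der (L : Module.End K Model) :
    LocFin fun i => ((i + 1 : ℕ) : K) • (L ^ (i + 1) * derP (i + 1)) :=
  locFin_of_mon fun s t g => by
    obtain ⟨N, hN⟩ := exists_pderiv_eq_zero g
    exact ⟨N, fun i hi => by simp [derP_mon, hN (i + 1) (by omega)]⟩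

lemma locFin_downU : LocFin fun i => mulP (i + 1) * downU ^ (i + 1) :=
  locFin_of_mon fun s t g =>
    ⟨s, fun i hi => by
      rw [Module.End.mul_apply, downU_pow_mon, if_neg (by omega), map_zero]⟩

lemma locFin_downV : LocFin fun i => mulP (i + 1) * downV ^ (i + 1) :=
  locFin_of_mon fun s t g =>
    ⟨t, fun i hi => by
      rw [Module.End.mul_apply, downV_pow_mon, if_neg (by omega), map_zero]⟩

/-- `∑ i L ^ i ∂/∂p_i`. -/
def raise (L : Module.End K Model) : Module.End K Model := lfsum _ (locFin_der L)

/-- `∑ p_i u ^ (-i)`, truncated. -/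
def lowerU : Module.End K Model := lfsum _ locFin_downU

/-- `∑ p_i v ^ (-i)`, truncated. -/
def lowerV : Module.End K Model := lfsum _ locFin_downV

lemma swapM_pow {u v : Module.End K Model} (h : swapM * u = v * swapM) (i : ℕ) :
    swapM * u ^ i = v ^ i * swapM :=
  SemiconjBy.pow_right (show SemiconjBy swapM u v from h) i

lemma swapM_mul_raise {u v : Module.End K Model} (h : swapM * u = v * swapM) :
    swapM * raise u = raise v * swapM := by
  rw [raise, raise, mul_lfsum, lfsum_mul]
  refine lfsum_congr _ _ fun i => ?_
  rw [mul_smul_comm, smul_mul_assoc, ← mul_assoc, swapM_pow h, mul_assoc, mul_assoc,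
    (coefCommute_swapM.derP _).eq]

lemma swapM_mul_lowerU : swapM * lowerU = lowerV * swapM := by
  rw [lowerU, lowerV, mul_lfsum, lfsum_mul]
  refine lfsum_congr _ _ fun i => ?_
  rw [← mul_assoc, (coefCommute_swapM.mulP _).eq, mul_assoc, mul_assoc, swapM_pow swapM_mul_downU]

lemma commute_raise {G L : Module.End K Model} (hG : CoefCommute G) (h : Commute G L) :
    Commute G (raise L) :=
  commute_lfsum _ fun _ => ((h.pow_right _).mul_right (hG.derP _)).smul_right _

lemma commute_lowerU {G : Module.End K Model} (hG : CoefCommute G) (h : Commute G downU) :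
    Commute G lowerU :=
  commute_lfsum _ fun _ => (hG.mulP _).mul_right (h.pow_right _)

lemma commute_lowerV {G : Module.End K Model} (hG : CoefCommute G) (h : Commute G downV) :
    Commute G lowerV :=
  commute_lfsum _ fun _ => (hG.mulP _).mul_right (h.pow_right _)

lemma commute_raiseV_raiseU : Commute (raise shiftV) (raise shiftU) :=
  commute_lfsum _ fun _ => Commute.smul_right (Commute.symm (commute_lfsum _ fun _ =>
    Commute.smul_right (Commute.mul_right
      (((commute_shiftU_shiftV.pow_pow _ _).mul_left
        ((coefCommute_shiftV.pow _).derP _).symm))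
      (((coefCommute_shiftU.pow _).derP _).mul_left (commute_derP_derP _ _))) _)) _

lemma commute_lowerV_lowerU : Commute lowerV lowerU :=
  commute_lfsum _ fun _ => Commute.symm (commute_lfsum _ fun _ =>
    Commute.mul_right
      ((commute_mulP_mulP _ _).mul_left ((coefCommute_downU.pow _).mulP _))
      (((coefCommute_downV.pow _).mulP _).symm.mul_left (commute_downU_downV.pow_pow _ _)))

lemma locFin_crossU : LocFin fun i => ((i + 1 : ℕ) : K) • (shiftV ^ (i + 1) * downU ^ (i + 1)) :=
  locFin_of_mon fun s t g =>
    ⟨s, fun i hi => by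
      rw [LinearMap.smul_apply, Module.End.mul_apply, downU_pow_mon, if_neg (by omega), map_zero,
        smul_zero]⟩

/-- `∑ i v ^ i u ^ (-i)`, truncated. -/
def cross : Module.End K Model := lfsum _ locFin_crossU

lemma raise_mul_mulP (L : Module.End K Model) (hL : CoefCommute L) (j : ℕ) :
    raise L * mulP (j + 1) - mulP (j + 1) * raise L = ((j + 1 : ℕ) : K) • L ^ (j + 1) := by
  have key (i : ℕ) : ((i + 1 : ℕ) : K) • (L ^ (i + 1) * derP (i + 1)) * mulP (j + 1)
      - mulP (j + 1) * ((i + 1 : ℕ) : K) • (L ^ (i + 1) * derP (i + 1))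
      = if i = j then ((i + 1 : ℕ) : K) • L ^ (i + 1) else 0 := by
    rw [smul_mul_assoc, mul_smul_comm, mul_assoc, derP_mul_mulP, mul_add, ← mul_assoc,
      ((hL.pow _).mulP _).eq, mul_assoc, smul_add]
    by_cases h : i = j
    · subst h
      simp
    · simp [h]
  rw [raise, lfsum_mul, mul_lfsum, lfsum_sub, lfsum_eq_single _ j]
  · rw [key, if_pos rfl]
  · intro i hi
    rw [key, if_neg hi]

lemma raiseV_lowerU : raise shiftV * lowerU - lowerU * raise shiftV = cross := by
  rw [lowerU, lfsum_mul, mul_lfsum, lfsum_sub, cross]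
  refine lfsum_congr _ _ fun i => ?_
  have h : Commute (downU ^ (i + 1)) (raise shiftV) :=
    commute_raise (coefCommute_downU.pow _) (commute_shiftV_downU.symm.pow_left _)
  rw [mul_assoc, h.eq, ← mul_assoc, ← mul_assoc, ← sub_mul, raise_mul_mulP _ coefCommute_shiftV,
    smul_mul_assoc]

lemma raiseU_lowerV :
    raise shiftU * lowerV - lowerV * raise shiftU = swapM * cross * swapM := by
  have h (a b : Module.End K Model) :
      swapM * (a * b) * swapM = swapM * a * swapM * (swapM * b * swapM) := by
    rw [mul_assoc (swapM * a) swapM, ← mul_assoc swapM (swapM * b) swapM, ← mul_assoc swapM swapM b,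
      swapM_mul_swapM, one_mul]
    noncomm_ring
  rw [← raiseV_lowerU, mul_sub, sub_mul, h, h, swapM_mul_raise swapM_mul_shiftV, swapM_mul_lowerU,
    mul_assoc _ swapM swapM, mul_assoc _ swapM swapM, swapM_mul_swapM, mul_one, mul_one]

lemma cross_mon : cross (mon s t g)
    = ∑ i ∈ Finset.range s, ((i + 1 : ℕ) : K) • mon (s - 1 - i) (t + 1 + i) g := by
  have h (i : ℕ) : (((i + 1 : ℕ) : K) • (shiftV ^ (i + 1) * downU ^ (i + 1))) (mon s t g)
      = if i + 1 ≤ s then ((i + 1 : ℕ) : K) • mon (s - 1 - i) (t + 1 + i) g else 0 := by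
    rw [LinearMap.smul_apply, Module.End.mul_apply, downU_pow_mon]
    split_ifs
    · rw [shiftV_pow_mon, show s - (i + 1) = s - 1 - i by omega,
        show t + (i + 1) = t + 1 + i by omega]
    · simp
  rw [cross, lfsum_apply, finsum_eq_sum_of_support_subset (s := Finset.range s)]
  · refine Finset.sum_congr rfl fun i hi => ?_
    rw [h, if_pos (Nat.succ_le_of_lt (Finset.mem_range.1 hi))]
  · intro i hi
    rw [Function.mem_support, h] at hi
    by_contra hc
    exact hi (if_neg fun h' => hc (by simpa using h'))

end Model

section ModelRelations

lemma twisted_commute_of_defects {𝕜 E : Type*} [Field 𝕜] [Ring E] [Algebra 𝕜 E] {a b c : 𝕜}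
    {rU rV lU lV dU dV SU SV T W W' : E} (hc : c ^ 2 = b * c + a)
    (h1 : rV * lU - lU * rV = W) (h2 : rU * lV - lV * rU = W')
    (h3 : rV * rU = rU * rV) (h4 : lV * lU = lU * lV) (h5 : dU * rV = rV * dU)
    (h6 : dV * rU = rU * dV) (h7 : dU * lV = lV * dU) (h8 : dV * lU = lU * dV)
    (h9 : dV * dU = dU * dV) (h10 : SU * rU + T * rU - rU * SU = SV * rV + T * rV - rV * SV)
    (h11 : SU * lU + T * lU - lU * SU = SV * lV + T * lV - lV * SV)
    (h12 : SU * dU + T * dU - dU * SU - (SV * dV + T * dV - dV * SV) = W - W')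
    (h13 : SU * SV + T * SV - SV * SU - T * SU = -(W - W')) :
    ((a • rV + lV + b • dV + c • SU) + c • T) * (a • rU + lU + b • dU + c • SV)
      = ((a • rU + lU + b • dU + c • SV) + c • T) * (a • rV + lV + b • dV + c • SU) := by
  have h14 : c ^ 2 • (W - W') = (b * c + a) • (W - W') := by rw [hc]
  simp only [mul_add, add_mul, mul_smul_comm, smul_mul_assoc, smul_add]
  linear_combination (norm := module) a • h1 - a • h2 + (a * a) • h3 + h4
    - (a * b) • h5 + (a * b) • h6 - b • h7 + b • h8 + (b * b) • h9
    + (c * a) • h10 + c • h11 + (c * b) • h12 + (c * c) • h13 - h14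

variable (s t : ℕ) (g : Coef)

lemma smul_add_self {M : Type*} [AddCommGroup M] [Module K M] (c : K) (x : M) :
    c • x + x = (c + 1) • x := by
  rw [add_smul, one_smul]

lemma sum_range_split {M : Type*} [AddCommMonoid M] (f : ℕ → M) (s t : ℕ) :
    ∑ k ∈ Finset.range s, f (s + t - k) + f t + ∑ k ∈ Finset.range t, f k
      = ∑ k ∈ Finset.range (s + t + 1), f k := by
  rw [show s + t + 1 = t + 1 + s by omega, Finset.sum_range_add, Finset.sum_range_succ,
    ← Finset.sum_range_reflect (fun x => f (t + 1 + x)), add_assoc, add_comm, add_comm (f t)]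
  congr 1
  refine Finset.sum_congr rfl fun k hk => ?_
  have := Finset.mem_range.1 hk
  congr 1
  omega

lemma sum_range_sum_range {M : Type*} [AddCommGroup M] [Module K M] (f : ℕ → M) (t : ℕ) :
    ∑ k ∈ Finset.range t, ∑ l ∈ Finset.range k, f l
      = ∑ l ∈ Finset.range t, ((t : K) - 1 - l) • f l := by
  induction t with
  | zero => simp
  | succ t ih =>
    rw [Finset.sum_range_succ, ih, ← Finset.sum_add_distrib, Finset.sum_range_succ]
    simp only [Nat.cast_add, Nat.cast_one, add_sub_cancel_right, sub_self, zero_smul, add_zero]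
    exact Finset.sum_congr rfl fun l _ => by rw [smul_add_self]; congr 1; ring

/-- The antisymmetric part of `cross`. -/
def skewCross : Module.End K Model := cross - swapM * cross * swapM

lemma skewCross_mon : skewCross (mon s t g)
    = ∑ x ∈ Finset.range (s + t + 1), ((s : K) - x) • mon x (s + t - x) g := by
  rw [add_comm s t, ← sum_range_split]
  simp only [skewCross, LinearMap.sub_apply, Module.End.mul_apply, swapM_mon, cross_mon, map_sum,
    map_smul, sub_self, zero_smul, add_zero]
  rw [sub_eq_add_neg, ← Finset.sum_neg_distrib, add_comm]
  congr 1
  · rw [← Finset.sum_range_reflect]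
    refine Finset.sum_congr rfl fun k hk => ?_
    have := Finset.mem_range.1 hk
    rw [← neg_smul, show t - 1 - (t - 1 - k) = k by omega,
      show s + 1 + (t - 1 - k) = t + s - k by omega,
      show t + s - (t + s - k) = k by omega, show t - 1 - k + 1 = t - k by omega,
      Nat.cast_sub (by omega), Nat.cast_sub (by omega)]
    congr 1
    push_cast
    ring
  · rw [← Finset.sum_range_reflect]
    refine Finset.sum_congr rfl fun k hk => ?_
    have := Finset.mem_range.1 hk
    rw [show s - 1 - (s - 1 - k) = k by omega, show t + 1 + (s - 1 - k) = t + s - k by omega,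
      show s - 1 - k + 1 = s - k by omega, Nat.cast_sub (by omega)]

lemma defect_deg : stairU * degU + swapM * degU - degU * stairU
    - (stairV * degV + swapM * degV - degV * stairV) = skewCross :=
  model_ext fun s t g => by
    rw [skewCross_mon, ← sum_range_split]
    simp only [LinearMap.sub_apply, LinearMap.add_apply, Module.End.mul_apply, swapM_mon, degU_mon,
      degV_mon, stairU_mon, stairV_mon, map_sum, map_smul, Finset.smul_sum]
    have h1 : ∑ x ∈ Finset.range s,
          ((s : K) - (s + t - x : ℕ)) • mon (s + t - x) (s + t - (s + t - x)) g
        = ∑ x ∈ Finset.range s, (s : K) • mon (s + t - x) x g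
          - ∑ x ∈ Finset.range s, ((s + t - x : ℕ) : K) • mon (s + t - x) x g := by
      rw [← Finset.sum_sub_distrib]
      refine Finset.sum_congr rfl fun k hk => ?_
      have := Finset.mem_range.1 hk
      rw [show s + t - (s + t - k) = k by omega, sub_smul]
    have h2 : ∑ x ∈ Finset.range t, ((s : K) - x) • mon x (s + t - x) g
        = ∑ x ∈ Finset.range t, ((s + t - x : ℕ) : K) • mon x (s + t - x) g
          - ∑ x ∈ Finset.range t, (t : K) • mon x (s + t - x) g := by
      rw [← Finset.sum_sub_distrib]
      refine Finset.sum_congr rfl fun k hk => ?_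
      have := Finset.mem_range.1 hk
      rw [Nat.cast_sub (by omega), Nat.cast_add, ← sub_smul]
      congr 1
      ring
    rw [h1, h2, show s + t - t = s by omega, sub_smul]
    abel

lemma defect_stair : stairU * stairV + swapM * stairV - stairV * stairU - swapM * stairU
    = -skewCross :=
  model_ext fun s t g => by
    rw [LinearMap.neg_apply, skewCross_mon, add_comm s t, ← sum_range_split]
    have h1 : stairU (stairV (mon s t g))
        = ∑ l ∈ Finset.range t, ((t : K) - 1 - l) • mon (s + t - l) l g := by
      rw [stairV_mon, map_sum, ← sum_range_sum_range]
      refine Finset.sum_congr rfl fun k hk => ?_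
      have := Finset.mem_range.1 hk
      rw [stairU_mon, show k + (s + t - k) = s + t by omega]
    have h2 : stairV (stairU (mon s t g))
        = ∑ l ∈ Finset.range s, ((s : K) - 1 - l) • mon l (s + t - l) g := by
      rw [stairU_mon, map_sum, ← sum_range_sum_range]
      refine Finset.sum_congr rfl fun k hk => ?_
      have := Finset.mem_range.1 hk
      rw [stairV_mon, show s + t - k + k = s + t by omega]
    simp only [LinearMap.sub_apply, LinearMap.add_apply, Module.End.mul_apply, h1, h2, sub_self,
      zero_smul, add_zero]
    simp only [stairU_mon, stairV_mon, map_sum, swapM_mon]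
    have h3 : ∑ k ∈ Finset.range t,
          ((s : K) - (t + s - k : ℕ)) • mon (t + s - k) (t + s - (t + s - k)) g
        = - (∑ l ∈ Finset.range t, ((t : K) - 1 - l) • mon (s + t - l) l g
          + ∑ l ∈ Finset.range t, mon (s + t - l) l g) := by
      rw [← Finset.sum_add_distrib, ← Finset.sum_neg_distrib]
      refine Finset.sum_congr rfl fun k hk => ?_
      have := Finset.mem_range.1 hk
      rw [show t + s - (t + s - k) = k by omega, add_comm t s, Nat.cast_sub (by omega),
        Nat.cast_add, smul_add_self, ← neg_smul]
      congr 1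
      ring
    have h4 : ∑ k ∈ Finset.range s, ((s : K) - k) • mon k (t + s - k) g
        = ∑ l ∈ Finset.range s, ((s : K) - 1 - l) • mon l (s + t - l) g
          + ∑ l ∈ Finset.range s, mon l (s + t - l) g := by
      rw [← Finset.sum_add_distrib]
      refine Finset.sum_congr rfl fun k hk => ?_
      rw [add_comm t s, smul_add_self]
      congr 1
      ring
    rw [h3, h4]
    abel

lemma defect_raise : stairU * raise shiftU + swapM * raise shiftU - raise shiftU * stairU
    = stairV * raise shiftV + swapM * raise shiftV - raise shiftV * stairV := by
  have h {S L : Module.End K Model} (hS : CoefCommute S) (c : K) (i : ℕ) :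
      S * (c • (L * derP i)) + swapM * (c • (L * derP i)) - c • (L * derP i) * S
        = c • ((S * L + swapM * L - L * S) * derP i) := by
    rw [mul_smul_comm, mul_smul_comm, smul_mul_assoc, mul_assoc L, ← (hS.derP i).eq, ← smul_add,
      ← smul_sub]
    congr 1
  refine defect_lfsum _ _ fun i => ?_
  rw [h coefCommute_stairU, h coefCommute_stairV,
    defect_symm_up swapM_mul_swapM commute_shiftU_shiftV swapM_mul_shiftU swapM_mul_shiftV
      stairU_mul_shiftU, swapM_conj_stairU]

lemma defect_lower : stairU * lowerU + swapM * lowerU - lowerU * stairU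
    = stairV * lowerV + swapM * lowerV - lowerV * stairV := by
  have h {S L : Module.End K Model} (hS : CoefCommute S) (i : ℕ) :
      S * (mulP i * L) + swapM * (mulP i * L) - mulP i * L * S
        = mulP i * (S * L + swapM * L - L * S) := by
    rw [← mul_assoc, ← mul_assoc, (hS.mulP i).eq, (coefCommute_swapM.mulP i).eq]
    noncomm_ring
  refine defect_lfsum _ _ fun i => ?_
  rw [h coefCommute_stairU, h coefCommute_stairV,
    defect_symm_down swapM_mul_swapM commute_downU_downV swapM_mul_downU swapM_mul_downV
      stairU_mul_downU, swapM_conj_stairU]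

/-- The model of `Λ_Ỹ`. -/
def modelA (c : K) : Module.End K Model :=
  alpha • raise shiftU + lowerU + bb • degU + c • stairV

/-- The model of `Λ_Z̃`. -/
def modelB (c : K) : Module.End K Model :=
  alpha • raise shiftV + lowerV + bb • degV + c • stairU

lemma swapM_mul_modelA (c : K) : swapM * modelA c = modelB c * swapM := by
  simp only [modelA, modelB, mul_add, add_mul, mul_smul_comm, smul_mul_assoc, swapM_mul_lowerU,
    swapM_mul_raise swapM_mul_shiftU, swapM_mul_degU, swapM_mul_stairV]

lemma modelB_mul_shiftU (c : K) :
    modelB c * shiftU = shiftU * (modelB c + c • swapM) := by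
  have h1 := (commute_raise coefCommute_shiftU commute_shiftU_shiftV).eq
  have h2 := (commute_lowerV coefCommute_shiftU commute_shiftU_downV).eq
  have h3 := commute_degV_shiftU.eq
  simp only [modelB, mul_add, add_mul, mul_smul_comm, smul_mul_assoc, ← h1, ← h2, h3,
    stairU_mul_shiftU, smul_add]
  abel

lemma modelA_mul_shiftV (c : K) :
    modelA c * shiftV = shiftV * (modelA c + c • swapM) := by
  have h := congrArg (fun F => swapM * F * swapM) (modelB_mul_shiftU c)
  have hA : swapM * modelB c * swapM = modelA c := by
    rw [mul_assoc, ← swapM_mul_modelA, ← mul_assoc, swapM_mul_swapM, one_mul]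
  have hu : swapM * shiftU * swapM = shiftV := by
    rw [swapM_mul_shiftU, mul_assoc, swapM_mul_swapM, mul_one]
  have hm (a b : Module.End K Model) :
      swapM * (a * b) * swapM = swapM * a * swapM * (swapM * b * swapM) := by
    rw [mul_assoc (swapM * a) swapM, ← mul_assoc swapM (swapM * b) swapM, ← mul_assoc swapM swapM b,
      swapM_mul_swapM, one_mul]
    noncomm_ring
  simpa only [hm, hA, hu, mul_add, add_mul, mul_smul_comm, smul_mul_assoc, swapM_mul_swapM,
    one_mul] using h

lemma modelB_modelA (c : K) (hc : c ^ 2 = bb * c + alpha) :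
    (modelB c + c • swapM) * modelA c = (modelA c + c • swapM) * modelB c :=
  twisted_commute_of_defects hc raiseV_lowerU raiseU_lowerV commute_raiseV_raiseU.eq
    commute_lowerV_lowerU.eq (commute_raise coefCommute_degU commute_degU_shiftV).eq
    (commute_raise coefCommute_degV commute_degV_shiftU).eq
    (commute_lowerV coefCommute_degU commute_degU_downV).eq
    (commute_lowerU coefCommute_degV commute_degV_downU).eq commute_degV_degU.eq
    defect_raise defect_lower defect_deg defect_stair

end ModelRelations

section Letters

/-- The index of a variable. -/
def Var.idx : Var → ℕ
  | Var.p i => i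
  | Var.y i => i
  | Var.y' i => i
  | Var.z i => i
  | Var.z' i => i

lemma exists_bound_pderiv (f : R) : ∃ N, ∀ v : Var, N ≤ v.idx → pderiv v f = 0 := by
  refine ⟨f.vars.sup Var.idx + 1, fun v hv => pderiv_eq_zero_of_notMem_vars fun h => ?_⟩
  have := Finset.le_sup (f := Var.idx) h
  omega

/-- An alphabet `a 0, a 1, …` of indexed variables other than the `p`-variables. -/
structure IsLetter (a : ℕ → Var) : Prop where
  idx : ∀ i, (a i).idx = i
  ne_p : ∀ i j, a i ≠ Var.p j

/-- The triple sums in `M_Y` and `M_Z`. -/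
def stairOp (c d a b : ℕ → Var) (f : R) : R :=
  ∑ᶠ (i : ℕ) (j : ℕ) (k : ℕ), X (d (i + j + 1)) * X (c k) *
    pderiv (b (i + k + 1)) (pderiv (a j) f)

/-- The double sums in `Δ`. -/
def exchangeOp (c d a b : ℕ → Var) (f : R) : R :=
  ∑ᶠ (i : ℕ) (j : ℕ), X (c i) * X (d j) * pderiv (a i) (pderiv (b j) f)

lemma isLinearMap_finsum {M : Type*} [AddCommGroup M] [Module K M] {F : ℕ → M → M}
    (hF : ∀ i, IsLinearMap K (F i)) (hfin : ∀ f, ∃ N, ∀ i, N ≤ i → F i f = 0) :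
    IsLinearMap K fun f => ∑ᶠ i, F i f :=
  LinearMap.isLinear (lfsum (fun i => (hF i).mk') hfin)

lemma IsLinearMap.add_fun {M : Type*} [AddCommGroup M] [Module K M] {F G : M → M}
    (hF : IsLinearMap K F) (hG : IsLinearMap K G) : IsLinearMap K fun f => F f + G f :=
  LinearMap.isLinear (hF.mk' F + hG.mk' G)

lemma IsLinearMap.smul_fun {M : Type*} [AddCommGroup M] [Module K M] {F : M → M}
    (hF : IsLinearMap K F) (c : K) : IsLinearMap K fun f => c • F f :=
  LinearMap.isLinear (c • hF.mk' F)

lemma isLinearMap_mul_pderiv (q : R) (v : Var) : IsLinearMap K fun f : R => q * pderiv v f :=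
  LinearMap.isLinear (LinearMap.mulLeft K q ∘ₗ (pderiv v).toLinearMap)

lemma isLinearMap_mul_pderiv_pderiv (q : R) (v w : Var) :
    IsLinearMap K fun f : R => q * pderiv v (pderiv w f) :=
  LinearMap.isLinear (LinearMap.mulLeft K q ∘ₗ (pderiv v).toLinearMap ∘ₗ (pderiv w).toLinearMap)

lemma exists_bound_mul_pderiv {w : ℕ → Var} (hw : ∀ i, i ≤ (w i).idx) (q : ℕ → R) (f : R) :
    ∃ N, ∀ i, N ≤ i → q i * pderiv (w i) f = 0 := by
  obtain ⟨N, hN⟩ := exists_bound_pderiv f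
  exact ⟨N, fun i hi => by rw [hN _ (hi.trans (hw i)), mul_zero]⟩

variable {a b c d : ℕ → Var}

lemma isLinearMap_Plus (ha : IsLetter a) : IsLinearMap K (Plus a) :=
  isLinearMap_finsum (fun _ => isLinearMap_mul_pderiv _ _)
    fun f => exists_bound_mul_pderiv (fun i => (ha.idx i).ge) _ f

lemma isLinearMap_Lam (ha : IsLetter a) : IsLinearMap K (Lam a) := by
  refine ((IsLinearMap.smul_fun ?_ _).add_fun ?_).add_fun (IsLinearMap.smul_fun ?_ _)
  · refine isLinearMap_finsum (fun i => isLinearMap_finsum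
      (fun j => (isLinearMap_mul_pderiv_pderiv _ _ _).smul_fun _) fun f => ?_) fun f => ?_
    · obtain ⟨N, hN⟩ := exists_bound_pderiv f
      exact ⟨N, fun j hj => by rw [hN (a j) (hj.trans (ha.idx j).ge)]; simp⟩
    · obtain ⟨N, hN⟩ := exists_bound_pderiv f
      refine ⟨N, fun i hi => finsum_eq_zero_of_forall_eq_zero fun j => ?_⟩
      rw [pderiv_pderiv_comm, hN (Var.p (i + 1)) (hi.trans (Nat.le_succ i))]
      simp
  · refine isLinearMap_finsum (fun i => isLinearMap_finsum
      (fun j => isLinearMap_mul_pderiv _ _) fun f => ?_) fun f => ?_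
    · exact exists_bound_mul_pderiv (fun j => by rw [ha.idx]; omega) _ f
    · obtain ⟨N, hN⟩ := exists_bound_pderiv f
      refine ⟨N, fun i hi => finsum_eq_zero_of_forall_eq_zero fun j => ?_⟩
      rw [hN (a (i + j + 1)) (by rw [ha.idx]; omega), mul_zero]
  · refine isLinearMap_finsum (fun i => (isLinearMap_mul_pderiv _ _).smul_fun _) fun f => ?_
    obtain ⟨N, hN⟩ := exists_bound_pderiv f
    exact ⟨N, fun j hj => by rw [hN (a (j + 1)) (by rw [ha.idx]; omega)]; simp⟩

lemma isLinearMap_stairOp (ha : IsLetter a) (hb : IsLetter b) :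
    IsLinearMap K (stairOp c d a b) := by
  refine isLinearMap_finsum (fun i => isLinearMap_finsum (fun j => isLinearMap_finsum
      (fun k => isLinearMap_mul_pderiv_pderiv _ _ _) fun f => ?_) fun f => ?_) fun f => ?_
  · exact exists_bound_mul_pderiv (fun k => by rw [hb.idx]; omega) _ _
  · obtain ⟨N, hN⟩ := exists_bound_pderiv f
    refine ⟨N, fun j hj => finsum_eq_zero_of_forall_eq_zero fun k => ?_⟩
    rw [hN (a j) (by rwa [ha.idx]), map_zero, mul_zero]
  · obtain ⟨N, hN⟩ := exists_bound_pderiv f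
    refine ⟨N, fun i hi => finsum_eq_zero_of_forall_eq_zero fun j =>
      finsum_eq_zero_of_forall_eq_zero fun k => ?_⟩
    rw [pderiv_pderiv_comm, hN (b (i + k + 1)) (by rw [hb.idx]; omega), map_zero, mul_zero]

lemma isLinearMap_exchangeOp (ha : IsLetter a) (hb : IsLetter b) :
    IsLinearMap K (exchangeOp c d a b) := by
  refine isLinearMap_finsum (fun i => isLinearMap_finsum
      (fun j => isLinearMap_mul_pderiv_pderiv _ _ _) fun f => ?_) fun f => ?_
  · obtain ⟨N, hN⟩ := exists_bound_pderiv f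
    exact ⟨N, fun j hj => by rw [hN (b j) (by rwa [hb.idx]), map_zero, mul_zero]⟩
  · obtain ⟨N, hN⟩ := exists_bound_pderiv f
    refine ⟨N, fun i hi => finsum_eq_zero_of_forall_eq_zero fun j => ?_⟩
    rw [pderiv_pderiv_comm, hN (a i) (by rwa [ha.idx]), map_zero, mul_zero]

/-! ### Vanishing -/

/-- No derivative in the alphabet `a` is nonzero. -/
def Free (a : ℕ → Var) (f : R) : Prop := ∀ j, pderiv (a j) f = 0

lemma Free.pderiv {f : R} (hf : Free a f) (v : Var) : Free a (pderiv v f) := fun j => by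
  rw [pderiv_pderiv_comm, hf, map_zero]

lemma Free.add {f g : R} (hf : Free a f) (hg : Free a g) : Free a (f + g) := fun j => by
  rw [map_add, hf, hg, add_zero]

lemma Free.smul {f : R} (hf : Free a f) (x : K) : Free a (x • f) := fun j => by
  rw [Derivation.map_smul, hf, smul_zero]

lemma Free.mul {f g : R} (hf : Free a f) (hg : Free a g) : Free a (f * g) := fun j => by
  rw [Derivation.leibniz, hf, hg, smul_zero, smul_zero, add_zero]

lemma free_zero : Free a 0 := fun _ => map_zero _

lemma free_finsum {F : ℕ → R} (hF : ∀ i, Free a (F i)) : Free a (∑ᶠ i, F i) :=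
  finsum_induction (Free a) free_zero (fun _ _ => Free.add) hF

lemma free_X {v : Var} (h : ∀ j, a j ≠ v) : Free a (X v) := fun j =>
  pderiv_X_of_ne (h j).symm

lemma Plus_eq_zero {f : R} (hf : Free a f) : Plus a f = 0 :=
  finsum_eq_zero_of_forall_eq_zero fun i => by rw [hf, mul_zero]

lemma Lam_eq_zero {f : R} (hf : Free a f) : Lam a f = 0 := by
  have h (i : ℕ) : pderiv (a i) f = 0 := hf i
  simp [Lam, h]

lemma stairOp_eq_zero_left {f : R} (hf : Free a f) : stairOp c d a b f = 0 := by
  have h (i : ℕ) : pderiv (a i) f = 0 := hf i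
  simp [stairOp, h]

lemma stairOp_eq_zero_right {f : R} (hf : Free b f) : stairOp c d a b f = 0 := by
  have h (i : ℕ) (j : ℕ) : pderiv (b i) (pderiv (a j) f) = 0 := hf.pderiv _ _
  simp [stairOp, h]

lemma exchangeOp_eq_zero_left {f : R} (hf : Free a f) : exchangeOp c d a b f = 0 := by
  have h (i : ℕ) (j : ℕ) : pderiv (a i) (pderiv (b j) f) = 0 := hf.pderiv _ _
  simp [exchangeOp, h]

lemma exchangeOp_eq_zero_right {f : R} (hf : Free b f) : exchangeOp c d a b f = 0 := by
  have h (i : ℕ) : pderiv (b i) f = 0 := hf i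
  simp [exchangeOp, h]

lemma Free.Plus {f : R} (hf : Free b f) (h : ∀ i j, b i ≠ a j) : Free b (Plus a f) :=
  free_finsum fun _ => (free_X fun j => h j _).mul (hf.pderiv _)

lemma Free.Lam {f : R} (hb : IsLetter b) (hf : Free b f) (h : ∀ i j, b i ≠ a j) :
    Free b (Lam a f) :=
  (((free_finsum fun _ => free_finsum fun _ =>
      ((free_X fun k => h k _).mul ((hf.pderiv _).pderiv _)).smul _).smul _).add
    (free_finsum fun _ => free_finsum fun _ =>
      ((free_X fun k => h k _).mul (free_X fun k => hb.ne_p k _)).mul (hf.pderiv _))).add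
    ((free_finsum fun _ => ((free_X fun k => h k _).mul (hf.pderiv _)).smul _).smul _)

/-! ### Evaluation on polynomials of bidegree one -/

/-- The inclusion of the coefficient polynomials. -/
def rho : Coef →ₐ[K] R := rename Var.p

lemma rho_X (i : ℕ) : rho (X i) = X (Var.p i) := rename_X _ _

lemma free_rho (ha : IsLetter a) (g : Coef) : Free a (rho g) := fun j => by
  induction g using MvPolynomial.induction_on with
  | C x => simp [rho]
  | add f g hf hg => rw [map_add, map_add, hf, hg, add_zero]
  | mul_X f i hf =>
    rw [map_mul, rho_X, Derivation.leibniz, hf, pderiv_X_of_ne (ha.ne_p j i).symm, smul_zero,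
      smul_zero, add_zero]

lemma pderiv_rho (i : ℕ) (g : Coef) : pderiv (Var.p i) (rho g) = rho (pderiv i g) := by
  induction g using MvPolynomial.induction_on with
  | C x => simp [rho]
  | add f g hf hg => rw [map_add, map_add, hf, hg, map_add, map_add]
  | mul_X f k hf =>
    rw [map_mul, rho_X, Derivation.leibniz, Derivation.leibniz, hf, map_add, smul_eq_mul,
      smul_eq_mul, smul_eq_mul, smul_eq_mul, map_mul, map_mul, rho_X]
    congr 2
    by_cases h : k = i
    · subst h
      simp
    · rw [pderiv_X_of_ne h, pderiv_X_of_ne (by simpa using h), map_zero]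

/-- Substitution of `a_s b_t` for the monomials of the model. -/
def pairing (a b : ℕ → Var) : Model →ₗ[K] R :=
  onMon fun s t => LinearMap.mulLeft K (X (a s) * X (b t)) ∘ₗ rho.toLinearMap

lemma pairing_mon (s t : ℕ) (g : Coef) :
    pairing a b (mon s t g) = X (a s) * (X (b t) * rho g) := by
  rw [pairing, onMon_mon, ← mul_assoc]
  rfl

lemma pairing_swapM (x : Model) : pairing a b (swapM x) = pairing b a x :=
  model_induction (p := fun x => pairing a b (swapM x) = pairing b a x) x (by simp)
    (fun x y hx hy => by rw [map_add, map_add, hx, hy, map_add]) fun s t g => by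
      rw [swapM_mon, pairing_mon, pairing_mon, mul_left_comm]

lemma apply_pairing_ext {F : R → R} (hF : IsLinearMap K F) {G : Model →ₗ[K] R}
    (h : ∀ s t g, F (pairing a b (mon s t g)) = G (mon s t g)) (x : Model) :
    F (pairing a b x) = G x :=
  LinearMap.congr_fun (model_ext (F := hF.mk' F ∘ₗ pairing a b) h) x

lemma IsLetter.injective (ha : IsLetter a) : Function.Injective a := fun i j h => by
  rw [← ha.idx i, h, ha.idx]

lemma IsLetter.pderiv_mul (ha : IsLetter a) (s j : ℕ) {h : R} (hh : Free a h) :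
    pderiv (a j) (X (a s) * h) = if j = s then h else 0 := by
  rw [Derivation.leibniz, hh, smul_zero, zero_add]
  split_ifs with hj
  · rw [hj, pderiv_X_self, smul_eq_mul, mul_one]
  · rw [pderiv_X_of_ne (fun e => hj (ha.injective e).symm), smul_zero]

lemma free_pairing_mon (hc : IsLetter c)
    (h₁ : ∀ i j, c i ≠ a j) (h₂ : ∀ i j, c i ≠ b j) (s t : ℕ) (g : Coef) :
    Free c (pairing a b (mon s t g)) := by
  rw [pairing_mon]
  exact (free_X fun j => h₁ j s).mul ((free_X fun j => h₂ j t).mul (free_rho hc g))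

lemma Plus_mul (ha : IsLetter a) (s : ℕ) {h : R} (hh : Free a h) :
    Plus a (X (a s) * h) = X (a (s + 1)) * h := by
  simp only [Plus, ha.pderiv_mul s _ hh, mul_ite, mul_zero]
  rw [finsum_eq_single _ s fun i hi => if_neg hi, if_pos rfl]

lemma finsum_ite_lt {M : Type*} [AddCommMonoid M] (s : ℕ) (f : ℕ → M) :
    ∑ᶠ i, (if i < s then f i else 0) = ∑ i ∈ Finset.range s, f i := by
  rw [finsum_eq_sum_of_support_subset (s := Finset.range s)]
  · exact Finset.sum_congr rfl fun i hi => if_pos (Finset.mem_range.1 hi)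
  · intro i hi
    by_contra hc
    exact hi (if_neg (by simpa using hc))

lemma finsum_ite_add {M : Type*} [AddCommMonoid M] (i s : ℕ) (f : ℕ → M) :
    ∑ᶠ j, (if i + j + 1 = s then f j else 0) = if i < s then f (s - i - 1) else 0 := by
  rw [finsum_eq_single _ (s - i - 1) fun j hj => if_neg (by omega)]
  exact if_congr (by omega) rfl rfl

lemma Lam_mul (ha : IsLetter a) (s : ℕ) {h : R} (hh : Free a h) :
    Lam a (X (a s) * h)
      = alpha • (∑ᶠ i : ℕ, ((i + 1 : ℕ) : K) • (X (a (s + (i + 1))) * pderiv (Var.p (i + 1)) h))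
        + ∑ k ∈ Finset.range s, X (a k) * (X (Var.p (s - k)) * h)
        + bb • ((s : K) • (X (a s) * h)) := by
  simp only [Lam, ha.pderiv_mul s _ hh]
  congr 2
  · congr 1
    refine finsum_congr fun i => ?_
    rw [finsum_eq_single _ s fun j hj => by rw [if_neg hj]; simp, if_pos rfl,
      show i + s + 1 = s + (i + 1) by omega]
  · simp only [mul_ite, mul_zero]
    rw [← finsum_ite_lt]
    refine finsum_congr fun i => ?_
    rw [finsum_ite_add]
    split_ifs with hi
    · rw [show s - i - 1 + 1 = s - i by omega, mul_assoc]
    · rfl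
  · cases s with
    | zero => simp
    | succ s =>
      rw [finsum_eq_single _ s fun j hj => by rw [if_neg (by omega)]; simp, if_pos rfl]

lemma lowerU_mon (s t : ℕ) (g : Coef) :
    lowerU (mon s t g) = ∑ k ∈ Finset.range s, mon k t (X (s - k) * g) := by
  rw [← Finset.sum_range_reflect, lowerU, lfsum_apply, ← finsum_ite_lt]
  refine finsum_congr fun i => ?_
  rw [Module.End.mul_apply, downU_pow_mon]
  by_cases h : i < s
  · rw [if_pos h, if_pos (Nat.succ_le_of_lt h), mulP_mon, show s - 1 - i = s - (i + 1) by omega,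
      show s - (s - (i + 1)) = i + 1 by omega]
  · rw [if_neg h, if_neg (by omega), map_zero]

lemma Plus_pairing (ha : IsLetter a) (hab : ∀ i j, a i ≠ b j) (x : Model) :
    Plus a (pairing a b x) = pairing a b (shiftU x) :=
  apply_pairing_ext (isLinearMap_Plus ha) (G := pairing a b ∘ₗ shiftU) (fun s t g => by
    rw [pairing_mon, Plus_mul ha s ((free_X fun j => hab j t).mul (free_rho ha g)),
      LinearMap.comp_apply, shiftU_mon, pairing_mon]) x

lemma Lam_pairing (ha : IsLetter a) (hb : IsLetter b) (hab : ∀ i j, a i ≠ b j) (x : Model) :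
    Lam a (pairing a b x) = pairing a b ((alpha • raise shiftU + lowerU + bb • degU) x) :=
  apply_pairing_ext (isLinearMap_Lam ha)
    (G := pairing a b ∘ₗ (alpha • raise shiftU + lowerU + bb • degU)) (fun s t g => by
    rw [pairing_mon, Lam_mul ha s ((free_X fun j => hab j t).mul (free_rho ha g))]
    simp only [LinearMap.comp_apply, LinearMap.add_apply, LinearMap.smul_apply, map_add, map_smul,
      degU_mon, lowerU_mon, map_sum, pairing_mon]
    congr 2
    · congr 1
      rw [raise, lfsum_apply, map_finsum _ ((locFin_der _).hasFiniteSupport _)]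
      refine finsum_congr fun i => ?_
      rw [LinearMap.smul_apply, Module.End.mul_apply, derP_mon, shiftU_pow_mon, map_smul,
        pairing_mon, Derivation.leibniz, pderiv_X_of_ne (hb.ne_p t _), smul_zero, add_zero,
        pderiv_rho, smul_eq_mul]
    · refine Finset.sum_congr rfl fun k _ => ?_
      rw [map_mul, rho_X, mul_left_comm (X (b t))]) x

lemma stairOp_pairing (ha : IsLetter a) (hb : IsLetter b) (hab : ∀ i j, a i ≠ b j) (x : Model) :
    stairOp c d a b (pairing a b x) = pairing c d (stairV x) :=
  apply_pairing_ext (isLinearMap_stairOp ha hb) (G := pairing c d ∘ₗ stairV) (fun s t g => by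
    have h₁ := (free_X fun j => hab j t).mul (free_rho ha g)
    have h₂ := free_rho hb g
    have hp (j k : ℕ) : pderiv (b k) (pderiv (a j) (X (a s) * (X (b t) * rho g)))
        = if j = s then (if k = t then rho g else 0) else 0 := by
      rw [ha.pderiv_mul s j h₁, apply_ite (pderiv (b k)), hb.pderiv_mul t k h₂, map_zero]
    simp only [pairing_mon, stairOp, hp, LinearMap.comp_apply, stairV_mon, map_sum]
    rw [← Finset.sum_range_reflect, ← finsum_ite_lt]
    refine finsum_congr fun i => ?_
    rw [finsum_eq_single _ s fun j hj => by simp [hj]]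
    simp only [if_true, mul_ite, mul_zero]
    rw [finsum_ite_add]
    split_ifs with hi
    · rw [show t - 1 - i = t - i - 1 by omega, show s + t - (t - i - 1) = i + s + 1 by omega]
      ring
    · rfl) x

lemma exchangeOp_pairing (ha : IsLetter a) (hb : IsLetter b) (hab : ∀ i j, a i ≠ b j)
    (x : Model) : exchangeOp c d a b (pairing a b x) = pairing c d x :=
  apply_pairing_ext (isLinearMap_exchangeOp ha hb) (G := pairing c d) (fun s t g => by
    have h₁ := (free_X fun j => hab j t).mul (free_rho ha g)
    have h₂ := free_rho hb g
    have hp (j k : ℕ) : pderiv (a j) (pderiv (b k) (X (a s) * (X (b t) * rho g)))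
        = if j = s then (if k = t then rho g else 0) else 0 := by
      rw [pderiv_pderiv_comm, ha.pderiv_mul s j h₁, apply_ite (pderiv (b k)),
        hb.pderiv_mul t k h₂, map_zero]
    simp only [pairing_mon, exchangeOp, hp]
    rw [finsum_eq_single _ s fun j hj => by simp [hj],
      finsum_eq_single _ t fun j hj => by simp [hj]]
    simp only [if_true, mul_assoc]) x

end Letters

section TwoAlphabets

/-- Four pairwise disjoint alphabets. -/
structure Alphabets (a a' b b' : ℕ → Var) : Prop where
  ha : IsLetter a
  ha' : IsLetter a'
  hb : IsLetter b
  hb' : IsLetter b'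
  haa' : ∀ i j, a i ≠ a' j
  hab : ∀ i j, a i ≠ b j
  hab' : ∀ i j, a i ≠ b' j
  ha'b : ∀ i j, a' i ≠ b j
  ha'b' : ∀ i j, a' i ≠ b' j
  hbb' : ∀ i j, b i ≠ b' j

/-- The common form of `Λ_Ỹ` and `Λ_Z̃`. -/
def twoLam (a a' b b' : ℕ → Var) (f : R) : R :=
  Lam a f + Lam a' f + (alpha • stairOp a' b' a b f + stairOp a b a' b' f
    + bb • stairOp a' b' a' b' f)

/-- The common form of `Ỹ_+` and `Z̃_+`. -/
def twoPlus (a a' : ℕ → Var) (f : R) : R := Plus a f + Plus a' f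

/-- The embedding of the model attached to a root `c` of `c ^ 2 = b c + α`. -/
def embed (a a' b b' : ℕ → Var) (c : K) : Model →ₗ[K] R := pairing a b + c • pairing a' b'

variable {a a' b b' : ℕ → Var}

lemma isLinearMap_twoLam (h : Alphabets a a' b b') : IsLinearMap K (twoLam a a' b b') :=
  ((isLinearMap_Lam h.ha).add_fun (isLinearMap_Lam h.ha')).add_fun
    ((((isLinearMap_stairOp h.ha h.hb).smul_fun _).add_fun
      (isLinearMap_stairOp h.ha' h.hb')).add_fun ((isLinearMap_stairOp h.ha' h.hb').smul_fun _))

lemma isLinearMap_twoPlus (h : Alphabets a a' b b') : IsLinearMap K (twoPlus a a') :=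
  (isLinearMap_Plus h.ha).add_fun (isLinearMap_Plus h.ha')

lemma free_pairing {c : ℕ → Var} (hc : IsLetter c) (h₁ : ∀ i j, c i ≠ a j) (h₂ : ∀ i j, c i ≠ b j)
    (x : Model) : Free c (pairing a b x) :=
  model_induction (p := fun x => Free c (pairing a b x)) x (by rw [map_zero]; exact free_zero)
    (fun x y hx hy => by rw [map_add]; exact hx.add hy) (free_pairing_mon hc h₁ h₂)

lemma Alphabets.free_left (h : Alphabets a a' b b') (x : Model) : Free a (pairing a' b' x) :=
  free_pairing h.ha h.haa' h.hab' x

lemma Alphabets.free_left' (h : Alphabets a a' b b') (x : Model) : Free a' (pairing a b x) :=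
  free_pairing h.ha' (fun i j => (h.haa' j i).symm) h.ha'b x

lemma Alphabets.swap (h : Alphabets a a' b b') : Alphabets b b' a a' where
  ha := h.hb
  ha' := h.hb'
  hb := h.ha
  hb' := h.ha'
  haa' := h.hbb'
  hab i j := (h.hab j i).symm
  hab' i j := (h.ha'b j i).symm
  ha'b i j := (h.hab' j i).symm
  ha'b' i j := (h.ha'b' j i).symm
  hbb' := h.haa'

lemma twoPlus_embed (h : Alphabets a a' b b') (c : K) (x : Model) :
    twoPlus a a' (embed a a' b b' c x) = embed a a' b b' c (shiftU x) := by
  simp only [twoPlus, embed, LinearMap.add_apply, LinearMap.smul_apply]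
  rw [(isLinearMap_Plus h.ha).map_add, (isLinearMap_Plus h.ha).map_smul,
    (isLinearMap_Plus h.ha').map_add, (isLinearMap_Plus h.ha').map_smul,
    Plus_pairing h.ha h.hab, Plus_pairing h.ha' h.ha'b', Plus_eq_zero (h.free_left x),
    Plus_eq_zero (h.free_left' x), smul_zero, add_zero, zero_add]

lemma twoLam_embed (h : Alphabets a a' b b') {c : K} (hc : c ^ 2 = bb * c + alpha) (x : Model) :
    twoLam a a' b b' (embed a a' b b' c x) = embed a a' b b' c (modelA c x) := by
  have hc' : bb * c + alpha = c * c := by rw [← hc, sq]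
  simp only [twoLam, embed, LinearMap.add_apply, LinearMap.smul_apply]
  rw [(isLinearMap_Lam h.ha).map_add, (isLinearMap_Lam h.ha).map_smul,
    (isLinearMap_Lam h.ha').map_add, (isLinearMap_Lam h.ha').map_smul,
    (isLinearMap_stairOp h.ha h.hb).map_add, (isLinearMap_stairOp h.ha h.hb).map_smul,
    (isLinearMap_stairOp h.ha' h.hb').map_add, (isLinearMap_stairOp h.ha' h.hb').map_smul,
    (isLinearMap_stairOp h.ha' h.hb').map_add, (isLinearMap_stairOp h.ha' h.hb').map_smul,
    Lam_pairing h.ha h.hb h.hab, Lam_pairing h.ha' h.hb' h.ha'b', Lam_eq_zero (h.free_left x),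
    Lam_eq_zero (h.free_left' x), stairOp_eq_zero_left (h.free_left x),
    stairOp_eq_zero_left (h.free_left' x), stairOp_eq_zero_left (h.free_left' x),
    stairOp_pairing h.ha h.hb h.hab, stairOp_pairing h.ha' h.hb' h.ha'b',
    stairOp_pairing h.ha' h.hb' h.ha'b', modelA, LinearMap.add_apply _ (c • stairV), map_add,
    map_add, LinearMap.smul_apply, map_smul, map_smul]
  simp only [smul_zero, add_zero, zero_add, smul_add, smul_smul]
  rw [← hc', add_smul]
  abel

/-- `twoLam` as an endomorphism. -/
def twoLamEnd (h : Alphabets a a' b b') : Module.End K R := (isLinearMap_twoLam h).mk'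

/-- `twoPlus` as an endomorphism. -/
def twoPlusEnd (h : Alphabets a a' b b') : Module.End K R := (isLinearMap_twoPlus h).mk'

lemma twoPlus_twoLam_iterate (h : Alphabets a a' b b') (n : ℕ) (f : R) :
    (twoPlusEnd h * twoLamEnd h ^ n) f = twoPlus a a' ((twoLam a a' b b')^[n] f) := by
  rw [Module.End.mul_apply, Module.End.pow_apply]
  rfl

lemma twoPlus_twoLam_embed (h : Alphabets a a' b b') {c : K} (hc : c ^ 2 = bb * c + alpha) (n : ℕ)
    (x : Model) : (twoPlusEnd h * twoLamEnd h ^ n) (embed a a' b b' c x)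
      = embed a a' b b' c ((shiftU * modelA c ^ n) x) := by
  have hn : (twoLamEnd h ^ n) (embed a a' b b' c x) = embed a a' b b' c ((modelA c ^ n) x) := by
    induction n with
    | zero => rfl
    | succ n ih =>
      rw [pow_succ', pow_succ', Module.End.mul_apply, ih, Module.End.mul_apply]
      exact twoLam_embed h hc _
  rw [Module.End.mul_apply, hn]
  exact twoPlus_embed h c _

lemma embed_swapM (c : K) (x : Model) :
    embed a a' b b' c (swapM x) = embed b b' a a' c x := by
  simp only [embed, LinearMap.add_apply, LinearMap.smul_apply, pairing_swapM]

lemma swapM_conj_modelA (c : K) (n : ℕ) :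
    swapM * (shiftU * modelA c ^ n) * swapM = shiftV * modelB c ^ n := by
  rw [← mul_assoc, swapM_mul_shiftU, mul_assoc, mul_assoc,
    ← mul_assoc swapM, involution_conj_pow swapM_mul_swapM (swapM_mul_modelA c)]

lemma twoPlus_twoLam_embed_swap (h : Alphabets a a' b b') {c : K} (hc : c ^ 2 = bb * c + alpha)
    (n : ℕ) (x : Model) : (twoPlusEnd h.swap * twoLamEnd h.swap ^ n) (embed a a' b b' c x)
      = embed a a' b b' c ((shiftV * modelB c ^ n) x) := by
  rw [← swapM_conj_modelA, ← embed_swapM, twoPlus_twoLam_embed h.swap hc, ← embed_swapM]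
  rfl

lemma twoLam_free (h : Alphabets a a' b b') {f : R} (hf : Free b f) (hf' : Free b' f) :
    Free b (twoLam a a' b b' f) ∧ Free b' (twoLam a a' b b' f) := by
  have hs : twoLam a a' b b' f = Lam a f + Lam a' f := by
    rw [twoLam, stairOp_eq_zero_right hf, stairOp_eq_zero_right hf', stairOp_eq_zero_right hf']
    simp
  rw [hs]
  exact ⟨(hf.Lam h.hb h.swap.hab).add (hf.Lam h.hb h.swap.hab'),
    (hf'.Lam h.hb' h.swap.ha'b).add (hf'.Lam h.hb' h.swap.ha'b')⟩

lemma twoPlus_twoLam_free (h : Alphabets a a' b b') (n : ℕ) {f : R} (hf : Free b f)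
    (hf' : Free b' f) : Free b ((twoPlusEnd h * twoLamEnd h ^ n) f) ∧
      Free b' ((twoPlusEnd h * twoLamEnd h ^ n) f) := by
  rw [twoPlus_twoLam_iterate]
  have key : Free b ((twoLam a a' b b')^[n] f) ∧ Free b' ((twoLam a a' b b')^[n] f) := by
    induction n with
    | zero => exact ⟨hf, hf'⟩
    | succ n ih =>
      rw [Function.iterate_succ_apply']
      exact twoLam_free h ih.1 ih.2
  exact ⟨(key.1.Plus h.swap.hab).add (key.1.Plus h.swap.hab'),
    (key.2.Plus h.swap.ha'b).add (key.2.Plus h.swap.ha'b')⟩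

lemma twoPlus_twoLam_eq_zero (h : Alphabets a a' b b') (n : ℕ) {f : R} (hf : Free a f)
    (hf' : Free a' f) : (twoPlusEnd h * twoLamEnd h ^ n) f = 0 := by
  have hP : twoPlusEnd h f = 0 := by
    change twoPlus a a' f = 0
    rw [twoPlus, Plus_eq_zero hf, Plus_eq_zero hf', add_zero]
  have hL : twoLamEnd h f = 0 := by
    change twoLam a a' b b' f = 0
    rw [twoLam, Lam_eq_zero hf, Lam_eq_zero hf', stairOp_eq_zero_left hf,
      stairOp_eq_zero_left hf', stairOp_eq_zero_left hf']
    simp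
  cases n with
  | zero => rw [pow_zero, mul_one, hP]
  | succ n => rw [pow_succ, Module.End.mul_apply, Module.End.mul_apply, hL, map_zero, map_zero]

lemma alphabets_yz : Alphabets Var.y Var.y' Var.z Var.z' := by
  constructor <;> first | (constructor <;> intros <;> first | rfl | exact Var.noConfusion) | simp

/-- `Ỹ_+ Λ_Ỹ^n` as an endomorphism. -/
def YLEnd (n : ℕ) : Module.End K R := twoPlusEnd alphabets_yz * twoLamEnd alphabets_yz ^ n

/-- `Z̃_+ Λ_Z̃^n` as an endomorphism. -/
def ZLEnd (n : ℕ) : Module.End K R :=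
  twoPlusEnd alphabets_yz.swap * twoLamEnd alphabets_yz.swap ^ n

lemma YLEnd_apply (n : ℕ) (f : R) : YLEnd n f = YL n f := twoPlus_twoLam_iterate _ _ _

lemma ZLEnd_apply (n : ℕ) (f : R) : ZLEnd n f = ZL n f := twoPlus_twoLam_iterate _ _ _

lemma Delta_eq (f : R) : Delta f = alpha • exchangeOp Var.z' Var.y' Var.y Var.z f
    + exchangeOp Var.z Var.y Var.y' Var.z' f + bb • exchangeOp Var.z' Var.y' Var.y' Var.z' f := rfl

lemma isLinearMap_Delta : IsLinearMap K Delta :=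
  have h := alphabets_yz
  (((isLinearMap_exchangeOp h.ha h.hb).smul_fun _).add_fun
    (isLinearMap_exchangeOp h.ha' h.hb')).add_fun ((isLinearMap_exchangeOp h.ha' h.hb').smul_fun _)

/-- The common value of both commutators, as an endomorphism. -/
def commutatorSum (n i : ℕ) : Module.End K R :=
  (∑ j ∈ Finset.range i, YLEnd (n + i - j - 1) * ZLEnd (n + j)) * isLinearMap_Delta.mk'

lemma commutatorSum_apply (n i : ℕ) (f : R) :
    commutatorSum n i f = ∑ j ∈ Finset.range i, YL (n + i - j - 1) (ZL (n + j) (Delta f)) := by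
  rw [commutatorSum, Module.End.mul_apply, LinearMap.sum_apply]
  refine Finset.sum_congr rfl fun j _ => ?_
  rw [Module.End.mul_apply, YLEnd_apply, ZLEnd_apply]
  rfl

/-- The polynomials on which the commutator formulas with given exponents hold. -/
def validSpace (n i : ℕ) : Submodule K R :=
  LinearMap.eqLocus (ZLEnd (n + i) * YLEnd n - YLEnd n * ZLEnd (n + i)) (commutatorSum n i) ⊓
    LinearMap.eqLocus (commutatorSum n i) (YLEnd (n + i) * ZLEnd n - ZLEnd n * YLEnd (n + i))

variable {n i : ℕ}

lemma mem_validSpace_of_free_z {f : R} (hf : Free Var.z f) (hf' : Free Var.z' f) :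
    f ∈ validSpace n i := by
  have hD : Delta f = 0 := by
    rw [Delta_eq, exchangeOp_eq_zero_right hf, exchangeOp_eq_zero_right hf',
      exchangeOp_eq_zero_right hf']
    simp
  have hZ (m : ℕ) : ZLEnd m f = 0 := twoPlus_twoLam_eq_zero alphabets_yz.swap m hf hf'
  have hZY (m k : ℕ) : ZLEnd m (YLEnd k f) = 0 :=
    twoPlus_twoLam_eq_zero alphabets_yz.swap m (twoPlus_twoLam_free alphabets_yz k hf hf').1
      (twoPlus_twoLam_free alphabets_yz k hf hf').2
  simp [validSpace, commutatorSum, hD, hZ, hZY]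

lemma mem_validSpace_of_free_y {f : R} (hf : Free Var.y f) (hf' : Free Var.y' f) :
    f ∈ validSpace n i := by
  have hD : Delta f = 0 := by
    rw [Delta_eq, exchangeOp_eq_zero_left hf, exchangeOp_eq_zero_left hf',
      exchangeOp_eq_zero_left hf']
    simp
  have hY (m : ℕ) : YLEnd m f = 0 := twoPlus_twoLam_eq_zero alphabets_yz m hf hf'
  have hYZ (m k : ℕ) : YLEnd m (ZLEnd k f) = 0 :=
    twoPlus_twoLam_eq_zero alphabets_yz m (twoPlus_twoLam_free alphabets_yz.swap k hf hf').1
      (twoPlus_twoLam_free alphabets_yz.swap k hf hf').2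
  simp [validSpace, commutatorSum, hD, hY, hYZ]

lemma Delta_embed {c : K} (hc : c ^ 2 = bb * c + alpha) (x : Model) :
    Delta (embed Var.y Var.y' Var.z Var.z' c x)
      = embed Var.y Var.y' Var.z Var.z' c ((c • swapM) x) := by
  have h := alphabets_yz
  have hc' : c * c = bb * c + alpha := by rw [← hc, sq]
  rw [LinearMap.smul_apply, map_smul, embed_swapM, Delta_eq]
  simp only [embed, LinearMap.add_apply, LinearMap.smul_apply]
  rw [(isLinearMap_exchangeOp h.ha h.hb).map_add, (isLinearMap_exchangeOp h.ha h.hb).map_smul,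
    (isLinearMap_exchangeOp h.ha' h.hb').map_add, (isLinearMap_exchangeOp h.ha' h.hb').map_smul,
    (isLinearMap_exchangeOp h.ha' h.hb').map_add, (isLinearMap_exchangeOp h.ha' h.hb').map_smul,
    exchangeOp_pairing h.ha h.hb h.hab, exchangeOp_pairing h.ha' h.hb' h.ha'b',
    exchangeOp_pairing h.ha' h.hb' h.ha'b', exchangeOp_eq_zero_left (h.free_left x),
    exchangeOp_eq_zero_left (h.free_left' x), exchangeOp_eq_zero_left (h.free_left' x)]
  simp only [smul_zero, add_zero, zero_add, smul_add, smul_smul]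
  rw [hc', add_smul]
  abel

lemma embed_mem_validSpace {c : K} (hc : c ^ 2 = bb * c + alpha) (x : Model) :
    embed Var.y Var.y' Var.z Var.z' c x ∈ validSpace n i := by
  set W := embed Var.y Var.y' Var.z Var.z' c with hW
  have hY (m : ℕ) (x : Model) : YLEnd m (W x) = W ((shiftU * modelA c ^ m) x) :=
    twoPlus_twoLam_embed alphabets_yz hc m x
  have hZ (m : ℕ) (x : Model) : ZLEnd m (W x) = W ((shiftV * modelB c ^ m) x) :=
    twoPlus_twoLam_embed_swap alphabets_yz hc m x
  have hD : (isLinearMap_Delta.mk' Delta) (W x) = W ((c • swapM) x) := Delta_embed hc x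
  have hS : commutatorSum n i (W x) = W ((c • ∑ j ∈ Finset.range i,
      shiftU * modelA c ^ (n + i - j - 1) * (shiftV * modelB c ^ (n + j)) * swapM) x) := by
    rw [commutatorSum, Module.End.mul_apply, hD, LinearMap.sum_apply, Finset.smul_sum,
      LinearMap.sum_apply, map_sum]
    refine Finset.sum_congr rfl fun j _ => ?_
    rw [Module.End.mul_apply, hZ, hY, ← mul_smul_comm]
    rfl
  obtain ⟨h₁, h₂⟩ := commutator_of_relations commute_shiftU_shiftV swapM_mul_swapM
    (swapM_mul_modelA c) (modelB_mul_shiftU c) (modelA_mul_shiftV c) (modelB_modelA c hc) n i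
  refine Submodule.mem_inf.2 ⟨?_, ?_⟩
  · rw [LinearMap.mem_eqLocus, hS, ← h₁, LinearMap.sub_apply, LinearMap.sub_apply, map_sub,
      Module.End.mul_apply, Module.End.mul_apply, hY, hZ, hZ, hY]
    rfl
  · rw [LinearMap.mem_eqLocus, hS, ← h₂, LinearMap.sub_apply, LinearMap.sub_apply, map_sub,
      Module.End.mul_apply (YLEnd _), Module.End.mul_apply (ZLEnd _), hY, hZ, hZ, hY]
    rfl

lemma alpha_add_one_ne_zero : alpha + 1 ≠ 0 := by
  have h : alpha + 1 = algebraMap (Polynomial ℚ) K (Polynomial.X + Polynomial.C 2) := by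
    rw [map_add, RatFunc.algebraMap_X, RatFunc.algebraMap_C]
    simp only [alpha, bb, map_ofNat]
    ring
  rw [h, Ne, FaithfulSMul.algebraMap_eq_zero_iff]
  exact Polynomial.X_add_C_ne_zero 2

lemma pairing_mem_validSpace (x : Model) : pairing Var.y Var.z x ∈ validSpace n i ∧
    pairing Var.y' Var.z' x ∈ validSpace n i := by
  have h₁ : embed Var.y Var.y' Var.z Var.z' alpha x ∈ validSpace n i :=
    embed_mem_validSpace (by simp only [alpha]; ring) x
  have h₂ : embed Var.y Var.y' Var.z Var.z' (-1) x ∈ validSpace n i :=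
    embed_mem_validSpace (by simp only [alpha]; ring) x
  have h₃ : pairing Var.y' Var.z' x ∈ validSpace n i := by
    refine ((validSpace n i).smul_mem_iff alpha_add_one_ne_zero).1 ?_
    convert (validSpace n i).sub_mem h₁ h₂ using 1
    simp only [embed, LinearMap.add_apply, LinearMap.smul_apply, add_smul, neg_smul, one_smul]
    abel
  refine ⟨?_, h₃⟩
  convert (validSpace n i).add_mem h₂ h₃ using 1
  simp [embed]

lemma PYZt_le_validSpace : PYZt ≤ validSpace n i := by
  have h := alphabets_yz
  have hp (f : R) (hf : f ∈ (Psub : Set R)) : ∃ g, f = rho g := by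
    obtain ⟨g, hg⟩ := exists_rename_eq_of_vars_subset_range f Var.p (fun _ _ => Var.p.inj)
      (mem_supported.1 hf)
    exact ⟨g, hg.symm⟩
  refine Submodule.span_le.2 ?_
  rintro f (hf | ⟨f, hf, ⟨s, rfl⟩ | ⟨s, rfl⟩ | ⟨s, t, rfl⟩ | ⟨s, rfl⟩ | ⟨s, rfl⟩ | ⟨s, t, rfl⟩⟩) <;>
    obtain ⟨g, rfl⟩ := hp f hf
  · exact mem_validSpace_of_free_z (free_rho h.hb g) (free_rho h.hb' g)
  · exact mem_validSpace_of_free_z ((free_X (by simp)).mul (free_rho h.hb g))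
      ((free_X (by simp)).mul (free_rho h.hb' g))
  · exact mem_validSpace_of_free_y ((free_X (by simp)).mul (free_rho h.ha g))
      ((free_X (by simp)).mul (free_rho h.ha' g))
  · rw [mul_assoc, ← pairing_mon]
    exact (pairing_mem_validSpace _).1
  · exact mem_validSpace_of_free_z ((free_X (by simp)).mul (free_rho h.hb g))
      ((free_X (by simp)).mul (free_rho h.hb' g))
  · exact mem_validSpace_of_free_y ((free_X (by simp)).mul (free_rho h.ha g))
      ((free_X (by simp)).mul (free_rho h.ha' g))
  · rw [mul_assoc, ← pairing_mon]
    exact (pairing_mem_validSpace _).2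

end TwoAlphabets

/-- **Explicit commutator formula** (equation (4.9) of Chapuy–Dołęga): for `m = n + i`,
`[Z̃_+Λ_Z̃^{m}, Ỹ_+Λ_Ỹ^{n}] = Σ_{j=1}^{i} Ỹ_+Λ_Ỹ^{n+i−j} Z̃_+Λ_Z̃^{n+j−1} Δ
  = [Ỹ_+Λ_Ỹ^{m}, Z̃_+Λ_Z̃^{n}]` on `𝒫_{Ỹ,Z̃}`. -/
theorem explicit_commutator (n i : ℕ) :
    ∀ f ∈ PYZt,
      (ZL (n + i) (YL n f) - YL n (ZL (n + i) f)
        = ∑ j ∈ Finset.range i, YL (n + i - j - 1) (ZL (n + j) (Delta f))) ∧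
      ((∑ j ∈ Finset.range i, YL (n + i - j - 1) (ZL (n + j) (Delta f)))
        = YL (n + i) (ZL n f) - ZL n (YL (n + i) f)) := by
  intro f hf
  have h := PYZt_le_validSpace (n := n) (i := i) hf
  rw [validSpace, Submodule.mem_inf, LinearMap.mem_eqLocus, LinearMap.mem_eqLocus,
    commutatorSum_apply] at h
  simpa only [LinearMap.sub_apply, Module.End.mul_apply, YLEnd_apply, ZLEnd_apply] using h
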